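/- arXiv:1611.03648 — 4 statements merged into one kernel-verified Lean document; each statement's English description precedes it below -/
import Mathlib

section
/- Let F be a maximum matching in a graph G and K = E(G) \ F. Then every F-augmenting F-alternating path (whose non-F edges need not lie in E(G)) contains an edge e not in E(G) such that OR(K ∪ {e}, F) strictly contains OR(K, F). -/
variable {V : Type*}

/-- A matching: a set of non-loop edges that are pairwise vertex-disjoint. -/
def IsMatching (M : Set (Sym2 V)) : Prop :=
  (∀ e ∈ M, ¬ e.IsDiag) ∧ ∀ e ∈ M, ∀ f ∈ M, e ≠ f → ∀ v, v ∈ e → v ∉ f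

/-- A vertex is covered by an edge set if it belongs to some edge. -/
def covered (M : Set (Sym2 V)) (v : V) : Prop := ∃ e ∈ M, v ∈ e

/-- A `K`–`F`-alternating path: a (simple) nonempty list of vertices whose
odd-numbered edges (0-indexed: even positions) lie in `K` and even-numbered edges lie in `F`. -/
def AltPath (K F : Set (Sym2 V)) (p : List V) : Prop :=
  p ≠ [] ∧ p.Nodup ∧ ∀ i, ∀ h : i + 1 < p.length,
    s(p[i]'(Nat.lt_of_succ_lt h), p[i+1]'h) ∈ (if i % 2 = 0 then K else F)


/-- `x` is evenly `K`-reachable from `a`: there is a `K`–`F`-alternating path from `a` to `x`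
with an even number of edges (an odd number of vertices); `x = a` via the empty path. -/
def evenReach (K F : Set (Sym2 V)) (a x : V) : Prop :=
  ∃ (p : List V) (hp : p ≠ []), AltPath K F p ∧ p.head hp = a ∧ p.getLast hp = x ∧
    Odd p.length

/-- `x` is oddly `K`-reachable from `a`: there is a `K`–`F`-alternating path from `a` to `x`
with an odd number of edges (an even, positive, number of vertices). -/
def oddReach (K F : Set (Sym2 V)) (a x : V) : Prop :=
  ∃ (p : List V) (hp : p ≠ []), AltPath K F p ∧ p.head hp = a ∧ p.getLast hp = x ∧
    Even p.length


/-- A maximum matching of the graph with edge set `E`. -/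
def IsMaxMatching (E F : Set (Sym2 V)) : Prop :=
  F ⊆ E ∧ IsMatching F ∧ ∀ M ⊆ E, IsMatching M → M.ncard ≤ F.ncard

/-- The edges of `F` contained in the vertex set `C` (the induced edge set `F[C]`). -/
def edgesIn (F : Set (Sym2 V)) (C : Set V) : Set (Sym2 V) := {e ∈ F | ∀ u ∈ e, u ∈ C}

/-- The edges of `E` avoiding the vertex set `S` (edges of `G − S`). -/
def avoid (E : Set (Sym2 V)) (S : Set V) : Set (Sym2 V) := {e ∈ E | ∀ u ∈ e, u ∉ S}

/-- The connected component of `v` in the graph with edge set `E'`. -/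
def comp (E' : Set (Sym2 V)) (v : V) : Set V :=
  {u | Relation.ReflTransGen (fun a b => s(a, b) ∈ E') v u}

/-- The induced subgraph on `C` is hypomatchable (factor-critical): for every `v ∈ C` there
is a matching inside `C` covering exactly `C \ {v}`. -/
def Hypomatchable (E : Set (Sym2 V)) (C : Set V) : Prop :=
  ∀ v ∈ C, ∃ M ⊆ edgesIn E C, IsMatching M ∧ ¬ covered M v ∧
    ∀ u ∈ C, u ≠ v → covered M u

/-- A Gallai–Edmonds decomposition `(Q, R, S)` of the graph `E` with respect to the maximum
matching `F`: (1) `F[Q]` is a perfect matching of `Q`; (2) `R` is a union of connected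
components of `G − S`, each hypomatchable and matched by `F` within itself except for exactly
one exposed vertex (its `r_i`); (3) every `s ∈ S` is matched by `F` to the exposed vertex
`r_i` of some component. -/
def IsGE (E F : Set (Sym2 V)) (Q R S : Set V) : Prop :=
  Q ∪ R ∪ S = Set.univ ∧ Disjoint Q R ∧ Disjoint Q S ∧ Disjoint R S ∧
  (∀ v ∈ Q, covered (edgesIn F Q) v) ∧
  (∀ v ∈ R, comp (avoid E S) v ⊆ R ∧ Hypomatchable E (comp (avoid E S) v) ∧
    (∃! w, w ∈ comp (avoid E S) v ∧ ¬ covered (edgesIn F (comp (avoid E S) v)) w)) ∧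
  (∀ s ∈ S, ∃ t, s(s, t) ∈ F ∧ t ∈ R ∧ ¬ covered (edgesIn F (comp (avoid E S) t)) t)

/-- `ER(K,F)`: the set of vertices evenly `K`-reachable from some `F`-uncovered vertex. -/
def ERset (K F : Set (Sym2 V)) : Set V := {x | ∃ a, ¬ covered F a ∧ evenReach K F a x}

/-- `OR(K,F)`: the set of vertices oddly `K`-reachable from some `F`-uncovered vertex. -/
def ORset (K F : Set (Sym2 V)) : Set V := {x | ∃ a, ¬ covered F a ∧ oddReach K F a x}

/-- An `F`-alternating path: odd-numbered edges (0-indexed even positions) are not in `F`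
(they need not be edges of any given graph), even-numbered edges are in `F`. -/
def FAlt (F : Set (Sym2 V)) (p : List V) : Prop :=
  p ≠ [] ∧ p.Nodup ∧ ∀ i, ∀ h : i + 1 < p.length,
    (i % 2 = 0 → s(p[i]'(Nat.lt_of_succ_lt h), p[i+1]'h) ∉ F) ∧
    (i % 2 = 1 → s(p[i]'(Nat.lt_of_succ_lt h), p[i+1]'h) ∈ F)

/-- The non-`F` (odd-numbered) edges of the path `p`. -/
def pathKEdges (p : List V) : Set (Sym2 V) :=
  {e | ∃ i, ∃ h : i + 1 < p.length, i % 2 = 0 ∧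
    e = s(p[i]'(Nat.lt_of_succ_lt h), p[i+1]'h)}

/-- All edges of the path `p`. -/
def pathAllEdges (p : List V) : Set (Sym2 V) :=
  {e | ∃ i, ∃ h : i + 1 < p.length,
    e = s(p[i]'(Nat.lt_of_succ_lt h), p[i+1]'h)}

/-- An `F`-augmenting `F`-alternating path: an odd number of edges (even number of vertices)
and both endpoints uncovered by `F`. -/
def Augmenting (F : Set (Sym2 V)) (p : List V) : Prop :=
  ∃ hp : p ≠ [], FAlt F p ∧ Even p.length ∧
    ¬ covered F (p.head hp) ∧ ¬ covered F (p.getLast hp)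


theorem covered_iff' (M : Set (Sym2 V)) (v : V) : covered M v ↔ ∃ w, s(v, w) ∈ M := by
  constructor
  · rintro ⟨e, he, hv⟩
    obtain ⟨w, rfl⟩ := Sym2.mem_iff_exists.mp hv
    exact ⟨w, he⟩
  · rintro ⟨w, hw⟩
    exact ⟨_, hw, Sym2.mem_mk_left _ _⟩

theorem IsMatching.uniq {M : Set (Sym2 V)} (hM : IsMatching M) {x y z : V}
    (h1 : s(x, y) ∈ M) (h2 : s(x, z) ∈ M) : y = z := by
  by_contra h
  refine hM.2 _ h1 _ h2 ?_ x (Sym2.mem_mk_left _ _) (Sym2.mem_mk_left _ _)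
  intro h'
  exact h (Sym2.congr_right.mp h')

theorem IsMatching.ne {M : Set (Sym2 V)} (hM : IsMatching M) {x y : V}
    (h1 : s(x, y) ∈ M) : x ≠ y := by
  intro h
  exact hM.1 _ h1 (by simpa using h)

theorem isMatching_of {M : Set (Sym2 V)} (h1 : ∀ x y, s(x, y) ∈ M → x ≠ y)
    (h2 : ∀ x y z, s(x, y) ∈ M → s(x, z) ∈ M → y = z) : IsMatching M := by
  constructor
  · intro e he hd
    induction e with
    | _ x y => exact h1 x y he (by simpa using hd)
  · intro e he f hf hne v hv hv'
    obtain ⟨w, rfl⟩ := Sym2.mem_iff_exists.mp hv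
    obtain ⟨w', rfl⟩ := Sym2.mem_iff_exists.mp hv'
    exact hne (by rw [h2 _ _ _ he hf])

theorem IsMatching.mono {M N : Set (Sym2 V)} (hM : IsMatching M) (h : N ⊆ M) : IsMatching N :=
  ⟨fun e he => hM.1 e (h he), fun e he f hf => hM.2 e (h he) f (h hf)⟩

theorem IsMatching.insert {M : Set (Sym2 V)} (hM : IsMatching M) {x y : V} (hxy : x ≠ y)
    (hx : ¬ covered M x) (hy : ¬ covered M y) : IsMatching (insert s(x, y) M) := by
  rw [covered_iff'] at hx hy
  push Not at hx hy
  apply isMatching_of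
  · intro a b hab
    rcases hab with hab | hab
    · rw [Sym2.eq_iff] at hab
      grind
    · exact hM.ne hab
  · intro a b c hab hac
    have := @IsMatching.uniq _ _ hM a b c
    simp only [Set.mem_insert_iff, Sym2.eq_iff] at hab hac
    grind

theorem insert_ncard [Fintype V] {M : Set (Sym2 V)} {x y : V}
    (hx : ¬ covered M x) : (insert s(x, y) M).ncard = M.ncard + 1 := by
  rw [covered_iff'] at hx
  push Not at hx
  exact Set.ncard_insert_of_notMem (hx y) (Set.toFinite _)

/-- swapping -/
theorem swap_lemma [Fintype V] {F : Set (Sym2 V)} (hF : IsMatching F) {r s t : V}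
    (hr : ¬ covered F r) (hst : s(s, t) ∈ F) :
    IsMatching (insert s(r, s) (F \ {s(s, t)})) ∧
    (insert s(r, s) (F \ {s(s, t)})).ncard = F.ncard ∧
    ∀ w, covered (insert s(r, s) (F \ {s(s, t)})) w ↔ (w = r ∨ (covered F w ∧ w ≠ t)) := by
  have hst' := hF.ne hst
  have hts : s(t, s) ∈ F := by rwa [Sym2.eq_swap]
  have hcs : covered F s := ⟨_, hst, Sym2.mem_mk_left _ _⟩
  have hrs : r ≠ s := by rintro rfl; exact hr hcs
  have hr' : ¬ covered (F \ {s(s, t)}) r := by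
    rintro ⟨e, he, h⟩; exact hr ⟨e, he.1, h⟩
  have hs' : ¬ covered (F \ {s(s, t)}) s := by
    rw [covered_iff']
    rintro ⟨w, hw, hne⟩
    exact hne (by rw [hF.uniq hw hst]; rfl)
  refine ⟨(hF.mono Set.sdiff_subset).insert hrs hr' hs', ?_, ?_⟩
  · rw [insert_ncard hr', Set.ncard_sdiff_singleton_add_one hst (Set.toFinite _)]
  · intro w
    have hrt : r ≠ t := by rintro rfl; exact hr ⟨_, hst, Sym2.mem_mk_right _ _⟩
    constructor
    · rw [covered_iff']
      rintro ⟨z, hz | hz⟩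
      · rw [Sym2.eq_iff] at hz
        rcases hz with ⟨rfl, rfl⟩ | ⟨rfl, rfl⟩
        · exact Or.inl rfl
        · exact Or.inr ⟨hcs, hst'⟩
      · refine Or.inr ⟨⟨_, hz.1, Sym2.mem_mk_left _ _⟩, ?_⟩
        rintro rfl
        apply hz.2
        rw [hF.uniq hz.1 hts, Sym2.eq_swap]; rfl
    · rintro (rfl | ⟨hw, hne⟩)
      · exact ⟨_, Or.inl rfl, Sym2.mem_mk_left _ _⟩
      · by_cases h : w = s
        · subst h
          exact ⟨_, Or.inl rfl, Sym2.mem_mk_right _ _⟩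
        · obtain ⟨e, he, hwe⟩ := hw
          refine ⟨e, Or.inr ⟨he, ?_⟩, hwe⟩
          rintro rfl
          rw [Sym2.mem_iff] at hwe
          tauto

theorem cov_ncard [Fintype V] {M : Set (Sym2 V)} (hM : IsMatching M) :
    {v | covered M v}.ncard = 2 * M.ncard := by
  classical
  have hfin : M.Finite := Set.toFinite _
  have : {v | covered M v} = ((hfin.toFinset.biUnion (fun e => e.toFinset) : Finset V) : Set V) := by
    ext v
    simp [covered]
  rw [this, Set.ncard_coe_finset, Finset.card_biUnion, Set.ncard_eq_toFinset_card _ hfin]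
  · rw [Finset.sum_const_nat (m := 2)]
    · ring
    · intro e he
      exact Sym2.card_toFinset_of_not_isDiag e (hM.1 e (by simpa using he))
  · intro e he f hf hne
    rw [Function.onFun, Finset.disjoint_left]
    intro v hv hv'
    exact hM.2 e (by simpa using he) f (by simpa using hf) hne v (by simpa using hv) (by simpa using hv')

/-- `u` and `v` are never both missed by a maximum matching (unless equal). -/
def Sim (E : Set (Sym2 V)) (u v : V) : Prop :=
  u = v ∨ ∀ M, IsMaxMatching E M → ¬ covered M u → covered M v

theorem Sim.trans [Fintype V] {E : Set (Sym2 V)} {u t v : V}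
    (h1 : Sim E u t) (h2 : Sim E t v)
    (ht : ∃ N, IsMaxMatching E N ∧ ¬ covered N t) : Sim E u v := by
  rcases h1 with rfl | h1
  · exact h2
  rcases h2 with rfl | h2
  · exact Or.inr h1
  by_cases huv : u = v
  · exact Or.inl huv
  refine Or.inr fun M hM hMu => ?_
  by_contra hMv
  let S : Set (Set (Sym2 V)) := {N | IsMaxMatching E N ∧ ¬ covered N t}
  obtain ⟨N, ⟨hN, hNt⟩, hmax⟩ := Set.exists_max_image S (fun N => (M ∩ N).ncard) (Set.toFinite _) ht
  have hNv : covered N v := h2 N hN hNt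
  have hNu : covered N u := by
    by_contra h
    exact hNt (h1 N hN h)
  have hc : N.ncard = M.ncard := le_antisymm (hM.2.2 N hN.1 hN.2.1) (hN.2.2 M hM.1 hM.2.1)
  have hcc : {v | covered N v}.ncard = {v | covered M v}.ncard := by
    rw [cov_ncard hN.2.1, cov_ncard hM.2.1, hc]
  have hd := Set.ncard_inter_add_ncard_sdiff_eq_ncard {v | covered N v} {v | covered M v} (Set.toFinite _)
  have hd' := Set.ncard_inter_add_ncard_sdiff_eq_ncard {v | covered M v} {v | covered N v} (Set.toFinite _)
  rw [Set.inter_comm] at hd'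
  have h2' : 1 < ({v | covered N v} \ {v | covered M v}).ncard := by
    rw [Set.one_lt_ncard (Set.toFinite _)]
    exact ⟨u, ⟨hNu, hMu⟩, v, ⟨hNv, hMv⟩, huv⟩
  obtain ⟨x, ⟨hxM, hxN⟩, hxt⟩ := Set.exists_ne_of_one_lt_ncard
    (s := {v | covered M v} \ {v | covered N v}) (by omega) t
  simp only [Set.mem_ofPred_eq] at hxM hxN
  obtain ⟨y, hxy⟩ := (covered_iff' _ _).mp hxM
  have hxney := hM.2.1.ne hxy
  have hyN : covered N y := by
    by_contra hyN
    have := hN.2.2 _ (Set.insert_subset (hM.1 hxy) hN.1) (hN.2.1.insert hxney hxN hyN)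
    rw [insert_ncard hxN] at this
    omega
  obtain ⟨z, hyz⟩ := (covered_iff' _ _).mp hyN
  obtain ⟨hm, hcard, hcov⟩ := swap_lemma hN.2.1 hxN hyz
  have hmem : insert s(x, y) (N \ {s(y, z)}) ∈ S := by
    refine ⟨⟨Set.insert_subset (hM.1 hxy) (Set.sdiff_subset.trans hN.1), hm, ?_⟩, ?_⟩
    · rw [hcard]; exact hN.2.2
    · rw [hcov]
      rintro (h | h)
      · exact hxt h.symm
      · exact hNt h.1
  have hle := hmax _ hmem
  have hlt : (M ∩ N) ⊂ (M ∩ insert s(x, y) (N \ {s(y, z)})) := by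
    rw [Set.ssubset_iff_of_subset]
    · refine ⟨s(x, y), ⟨hxy, Or.inl rfl⟩, fun h => hxN ⟨_, h.2, Sym2.mem_mk_left _ _⟩⟩
    · rintro e ⟨heM, heN⟩
      refine ⟨heM, Or.inr ⟨heN, ?_⟩⟩
      rintro rfl
      rw [Sym2.eq_swap] at hxy
      have : x = z := hM.2.1.uniq hxy heM
      subst this
      exact hxN ⟨_, heN, Sym2.mem_mk_right _ _⟩
  have := Set.ncard_lt_ncard hlt (Set.toFinite _)
  omega

theorem mem_ORset {K F : Set (Sym2 V)} {x : V} : x ∈ ORset K F ↔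
    ∃ p a, AltPath K F p ∧ p.head? = some a ∧ ¬ covered F a ∧ p.getLast? = some x ∧
      p.length % 2 = 0 := by
  constructor
  · rintro ⟨a, ha, p, hp, h, h1, h2, h3⟩
    refine ⟨p, a, h, ?_, ha, ?_, Nat.even_iff.mp h3⟩
    · rw [List.head?_eq_some_head hp, h1]
    · rw [List.getLast?_eq_some_getLast hp, h2]
  · rintro ⟨p, a, h, h1, ha, h2, h3⟩
    have hp := h.1
    refine ⟨a, ha, p, hp, h, ?_, ?_, Nat.even_iff.mpr h3⟩
    · rw [List.head?_eq_some_head hp] at h1; simpa using h1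
    · rw [List.getLast?_eq_some_getLast hp] at h2; simpa using h2

theorem mem_ERset {K F : Set (Sym2 V)} {x : V} : x ∈ ERset K F ↔
    ∃ p a, AltPath K F p ∧ p.head? = some a ∧ ¬ covered F a ∧ p.getLast? = some x ∧
      p.length % 2 = 1 := by
  constructor
  · rintro ⟨a, ha, p, hp, h, h1, h2, h3⟩
    refine ⟨p, a, h, ?_, ha, ?_, Nat.odd_iff.mp h3⟩
    · rw [List.head?_eq_some_head hp, h1]
    · rw [List.getLast?_eq_some_getLast hp, h2]
  · rintro ⟨p, a, h, h1, ha, h2, h3⟩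
    have hp := h.1
    refine ⟨a, ha, p, hp, h, ?_, ?_, Nat.odd_iff.mpr h3⟩
    · rw [List.head?_eq_some_head hp] at h1; simpa using h1
    · rw [List.getLast?_eq_some_getLast hp] at h2; simpa using h2

theorem AltPath.mono {K F K' F' : Set (Sym2 V)} {p : List V} (h : AltPath K F p)
    (hK : K ⊆ K') (hF : F ⊆ F') : AltPath K' F' p := by
  refine ⟨h.1, h.2.1, fun i hi => ?_⟩
  have := h.2.2 i hi
  split_ifs at this ⊢
  · exact hK this
  · exact hF this

theorem AltPath.pre {K F : Set (Sym2 V)} {a b : List V} (h : AltPath K F (a ++ b))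
    (ha : a ≠ []) : AltPath K F a := by
  refine ⟨ha, h.2.1.of_append_left, fun i hi => ?_⟩
  have := h.2.2 i (by simp; omega)
  grind

theorem AltPath.suf {K F : Set (Sym2 V)} {a b : List V} (h : AltPath K F (a ++ b))
    (ha : a.length % 2 = 0) (hb : b ≠ []) : AltPath K F b := by
  refine ⟨hb, h.2.1.of_append_right, fun i hi => ?_⟩
  have := h.2.2 (a.length + i) (by simp; omega)
  have h2 : (a.length + i) % 2 = i % 2 := by omega
  rw [h2] at this
  grind

theorem AltPath.rev {K F : Set (Sym2 V)} {a : List V} (h : AltPath K F a)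
    (ha : a.length % 2 = 0) : AltPath K F a.reverse := by
  refine ⟨by simpa using h.1, by simpa using h.2.1, fun i hi => ?_⟩
  simp only [List.length_reverse] at hi
  have := h.2.2 (a.length - 2 - i) (by omega)
  have h2 : (a.length - 2 - i) % 2 = i % 2 := by omega
  rw [h2, Sym2.eq_swap] at this
  simp only [List.getElem_reverse]
  have e1 : a.length - 2 - i + 1 = a.length - 1 - i := by omega
  have e2 : a.length - 2 - i = a.length - 1 - (i + 1) := by omega
  grind

theorem AltPath.combine {K F : Set (Sym2 V)} {T Q1 Q2 : List V} {t : V}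
    (hT : AltPath K F (T ++ [t])) (hQ : AltPath K F (Q1 ++ t :: Q2))
    (hd : ∀ x ∈ T, x ∉ Q2) (hQe : (Q1.length + Q2.length) % 2 = 1)
    (he : (T.length + Q2.length) % 2 = 1) : AltPath K F (T ++ t :: Q2) := by
  refine ⟨by simp, ?_, fun i hi => ?_⟩
  · have h1 := hT.2.1
    have h2 := hQ.2.1.of_append_right
    grind
  · by_cases hlt : i < T.length
    · have := hT.2.2 i (by simp; omega)
      grind
    · simp only [List.length_append, List.length_cons] at hi
      have := hQ.2.2 (Q1.length + (i - T.length)) (by simp; omega)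
      have h2 : (Q1.length + (i - T.length)) % 2 = i % 2 := by omega
      rw [h2] at this
      grind

theorem first_hit {K F : Set (Sym2 V)} {T Q : List V}
    (hT : AltPath K F T) (hQ : AltPath K F Q) (hQe : Q.length % 2 = 0)
    (hx : ∃ x ∈ T, x ∈ Q) : ∃ P, AltPath K F P ∧ P.head? = T.head? ∧ P.length % 2 = 0 ∧
      (P.getLast? = Q.head? ∨ P.getLast? = Q.getLast?) := by
  classical
  -- split at the first hit
  obtain ⟨T0, t, T1, rfl, htQ, hd⟩ : ∃ T0 t T1, T = T0 ++ t :: T1 ∧ t ∈ Q ∧ ∀ x ∈ T0, x ∉ Q := by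
    clear hT
    induction T with
    | nil => simp at hx
    | cons a T ih =>
      by_cases ha : a ∈ Q
      · exact ⟨[], a, T, rfl, ha, by simp⟩
      · obtain ⟨T0, t, T1, rfl, h1, h2⟩ := ih (by grind)
        exact ⟨a :: T0, t, T1, rfl, h1, by grind⟩
  have hT' : AltPath K F (T0 ++ [t]) := by
    apply AltPath.pre (b := T1) _ (by simp)
    simpa using hT
  obtain ⟨Q1, Q2, rfl⟩ := List.append_of_mem htQ
  have hl : (Q1.length + Q2.length) % 2 = 1 := by
    simp at hQe; omega
  by_cases hp : (T0.length + Q2.length) % 2 = 1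
  · refine ⟨T0 ++ t :: Q2, hT'.combine hQ (by grind) hl hp, ?_, by simp; omega, Or.inr ?_⟩
    · cases T0 <;> simp
    · rw [List.getLast?_append_of_ne_nil _ (by simp), List.getLast?_append_of_ne_nil _ (by simp)]
  · have hr := hQ.rev hQe
    have e : (Q1 ++ t :: Q2).reverse = Q2.reverse ++ t :: Q1.reverse := by simp
    rw [e] at hr
    refine ⟨T0 ++ t :: Q1.reverse, hT'.combine hr (by grind) (by simp; omega) (by simp; omega),
      ?_, by simp; omega, Or.inl ?_⟩
    · cases T0 <;> simp
    · rw [List.getLast?_append_of_ne_nil _ (by simp)]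
      cases Q1 with
      | nil => simp
      | cons q Q1 =>
        have e' : t :: (q :: Q1).reverse = (t :: Q1.reverse) ++ [q] := by simp
        rw [e', List.getLast?_append_of_ne_nil _ (by simp)]
        simp

theorem AltPath.mem_edge {K F : Set (Sym2 V)} {Q : List V} (hQ : AltPath K F Q)
    (hQe : Q.length % 2 = 0) {x : V} (hx : x ∈ Q) : ∃ y ∈ Q, s(x, y) ∈ K := by
  obtain ⟨i, hi, rfl⟩ := List.getElem_of_mem hx
  by_cases hp : i % 2 = 0
  · have := hQ.2.2 i (by omega)
    rw [if_pos hp] at this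
    exact ⟨_, List.getElem_mem _, this⟩
  · have := hQ.2.2 (i - 1) (by omega)
    rw [if_pos (by omega), Sym2.eq_swap] at this
    have e : i - 1 + 1 = i := by omega
    simp only [e] at this
    exact ⟨_, List.getElem_mem _, this⟩

theorem AltPath.cons2 {K F : Set (Sym2 V)} {u v w : V} {Q : List V} (hQ : AltPath K F (w :: Q))
    (h1 : s(u, v) ∈ K) (h2 : s(v, w) ∈ F) (huv : u ≠ v) (hu : u ∉ w :: Q) (hv : v ∉ w :: Q) :
    AltPath K F (u :: v :: w :: Q) := by
  refine ⟨by simp, ?_, ?_⟩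
  · have := hQ.2.1
    grind
  · intro i hi
    match i with
    | 0 => simpa using h1
    | 1 => simpa using h2
    | i + 2 =>
      have := hQ.2.2 i (by simpa using hi)
      simpa using this

theorem berge [Fintype V] {M : Set (Sym2 V)} (hM : IsMatching M) (n : ℕ) :
    ∀ F : Set (Sym2 V), IsMatching F → F.ncard < M.ncard → (M \ F).ncard ≤ n →
    ∃ Q a b, AltPath (M \ F) F Q ∧ Q.length % 2 = 0 ∧ Q.head? = some a ∧ Q.getLast? = some b ∧
      ¬ covered F a ∧ ¬ covered F b := by
  induction n with
  | zero =>
    intro F hF hlt hn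
    have h0 : M \ F = ∅ := by
      rw [← Set.ncard_eq_zero (Set.toFinite _)]; omega
    have := Set.ncard_le_ncard (Set.sdiff_eq_empty.mp h0) (Set.toFinite _)
    omega
  | succ n ih =>
    intro F hF hlt hn
    have hcl : {v | covered F v}.ncard < {v | covered M v}.ncard := by
      rw [cov_ncard hF, cov_ncard hM]; omega
    obtain ⟨u, huM, huF⟩ := Set.exists_mem_notMem_of_ncard_lt_ncard hcl (Set.toFinite _)
    simp only [Set.mem_ofPred_eq] at huM huF
    obtain ⟨v, huv⟩ := (covered_iff' _ _).mp huM
    have hne := hM.ne huv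
    have huvF : s(u, v) ∉ F := fun h => huF ⟨_, h, Sym2.mem_mk_left _ _⟩
    by_cases hvF : covered F v
    · obtain ⟨w, hvw⟩ := (covered_iff' _ _).mp hvF
      have hvwne := hF.ne hvw
      have hwu : w ≠ u := by
        rintro rfl; exact huF ⟨_, hvw, Sym2.mem_mk_right _ _⟩
      have hvwM : s(v, w) ∉ M := by
        intro h
        rw [Sym2.eq_swap] at huv
        exact hwu (hM.uniq h huv)
      obtain ⟨hm, hcard, hcov⟩ := swap_lemma hF huF hvw
      set F1 := insert s(u, v) (F \ {s(v, w)}) with hF1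
      have hsub : M \ F1 ⊆ M \ F := by
        rintro e ⟨heM, heF⟩
        refine ⟨heM, fun h => heF (Or.inr ⟨h, ?_⟩)⟩
        rintro rfl
        exact hvwM heM
      have hss : M \ F1 ⊂ M \ F := by
        rw [Set.ssubset_iff_of_subset hsub]
        exact ⟨_, ⟨huv, huvF⟩, fun h => h.2 (Or.inl rfl)⟩
      have := Set.ncard_lt_ncard hss (Set.toFinite _)
      obtain ⟨Q, a, b, hQ, hQe, hQa, hQb, ha, hb⟩ := ih F1 hm (by omega) (by omega)
      have huQ : u ∉ Q := by
        intro h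
        obtain ⟨y, -, hy⟩ := hQ.mem_edge hQe h
        have := hM.uniq hy.1 huv
        subst this
        exact hy.2 (Or.inl rfl)
      have hvQ : v ∉ Q := by
        intro h
        obtain ⟨y, -, hy⟩ := hQ.mem_edge hQe h
        have hvu := huv
        rw [Sym2.eq_swap] at hvu
        have := hM.uniq hy.1 hvu
        subst this
        exact hy.2 (Or.inl Sym2.eq_swap)
      have hQ' : AltPath (M \ F) F Q := by
        refine ⟨hQ.1, hQ.2.1, fun i hi => ?_⟩
        have h := hQ.2.2 i hi
        split_ifs at h ⊢
        · exact hsub h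
        · rcases h with h | h
          · exfalso
            apply huQ
            have h3 : u ∈ s(Q[i], Q[i+1]) := by rw [h]; exact Sym2.mem_mk_left _ _
            rw [Sym2.mem_iff] at h3
            rcases h3 with h3 | h3 <;> rw [h3] <;> exact List.getElem_mem _
          · exact h.1
      have key : ∀ R c d, AltPath (M \ F) F R → R.length % 2 = 0 → R.head? = some c →
          R.getLast? = some d → u ∉ R → v ∉ R → c = w → ¬ covered F1 d →
          ∃ Q a b, AltPath (M \ F) F Q ∧ Q.length % 2 = 0 ∧ Q.head? = some a ∧
          Q.getLast? = some b ∧ ¬ covered F a ∧ ¬ covered F b := by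
        intro R c d hR hRe hc hd' hu hv hcw hd
        match R, hR with
        | [], hR => exact absurd rfl hR.1
        | r :: R, hR =>
          have : r = w := by simpa [hcw] using hc
          subst this
          refine ⟨u :: v :: r :: R, u, d, hR.cons2 ⟨huv, huvF⟩ hvw hne hu hv, ?_, rfl, ?_, huF, ?_⟩
          · simp at hRe ⊢; omega
          · simpa using hd'
          · intro hcd
            apply hd
            rw [hcov]
            refine Or.inr ⟨hcd, ?_⟩
            rintro rfl
            have hnd := hR.2.1
            cases R with
            | nil => simp at hRe
            | cons q R =>
              have : d ∈ q :: R := by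
                apply List.mem_of_getLast?
                simpa using hd'
              exact (List.nodup_cons.mp hnd).1 this
      by_cases haw : a = w
      · exact key Q a b hQ' hQe hQa hQb huQ hvQ haw hb
      by_cases hbw : b = w
      · exact key Q.reverse b a (hQ'.rev hQe) (by simpa using hQe) (by simpa using hQb)
          (by simpa using hQa) (by simpa using huQ) (by simpa using hvQ) hbw ha
      refine ⟨Q, a, b, hQ', hQe, hQa, hQb, fun h => ha ?_, fun h => hb ?_⟩
      · rw [hcov]; exact Or.inr ⟨h, haw⟩
      · rw [hcov]; exact Or.inr ⟨h, hbw⟩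
    · refine ⟨[u, v], u, v, ⟨by simp, by simpa using hne, ?_⟩, by simp, rfl, rfl, huF, hvF⟩
      intro i hi
      have : i = 0 := by simp at hi; omega
      subst this
      simpa using ⟨huv, huvF⟩

theorem switch [Fintype V] {K : Set (Sym2 V)} (n : ℕ) :
    ∀ (F : Set (Sym2 V)) (Q : List V) (a b : V), Q.length ≤ n → IsMatching F → AltPath K F Q →
    Q.head? = some a → Q.getLast? = some b → ¬ covered F a →
    (Q.length % 2 = 1 → ∃ M ⊆ K ∪ F, IsMatching M ∧ M.ncard = F.ncard ∧ ¬ covered M b) ∧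
    (Q.length % 2 = 0 → ¬ covered F b → ∃ M ⊆ K ∪ F, IsMatching M ∧ M.ncard = F.ncard + 1) := by
  induction n with
  | zero =>
    intro F Q a b hl hF hQ
    exact absurd (by simpa using hl) hQ.1
  | succ n ih =>
    intro F Q a b hl hF hQ hQa hQb ha
    match Q, hQ with
    | [], hQ => exact absurd rfl hQ.1
    | [x], hQ =>
      simp only [List.head?_cons, Option.some.injEq, List.getLast?_singleton] at hQa hQb
      subst hQa hQb
      refine ⟨fun _ => ⟨F, Set.subset_union_right, hF, rfl, ha⟩, fun h => by simp at h⟩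
    | [x, y], hQ =>
      simp at hQa hQb
      subst hQa hQb
      refine ⟨fun h => by simp at h, fun _ hy => ⟨insert s(x, y) F, ?_, ?_, ?_⟩⟩
      · have := hQ.2.2 0 (by simp)
        simp at this
        exact Set.insert_subset (Or.inl this) Set.subset_union_right
      · exact hF.insert (by simpa using hQ.2.1) ha hy
      · exact insert_ncard ha
    | x :: y :: z :: R, hQ =>
      have hax : x = a := by simpa using hQa
      subst hax
      have hnd := hQ.2.1
      have hxy : s(x, y) ∈ K := by simpa using hQ.2.2 0 (by simp)
      have hyz : s(y, z) ∈ F := by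
        have := hQ.2.2 1 (by simp)
        exact this
      obtain ⟨hm, hcard, hcov⟩ := swap_lemma hF ha hyz
      set F1 := insert s(x, y) (F \ {s(y, z)}) with hF1
      have hQ2 : AltPath K F (z :: R) := AltPath.suf (a := [x, y]) hQ (by simp) (by simp)
      have hQ' : AltPath K F1 (z :: R) := by
        refine ⟨by simp, hQ2.2.1, fun i hi => ?_⟩
        have h := hQ2.2.2 i hi
        split_ifs at h ⊢
        · exact h
        · refine Or.inr ⟨h, ?_⟩
          intro h4
          have h3 : y ∈ s((z :: R)[i], (z :: R)[i+1]) := by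
            rw [Set.mem_singleton_iff.mp h4]; exact Sym2.mem_mk_left _ _
          have : y ∈ z :: R := by
            rw [Sym2.mem_iff] at h3
            rcases h3 with h3 | h3 <;> rw [h3] <;> exact List.getElem_mem _
          grind
      have hb' : (z :: R).getLast? = some b := by simpa using hQb
      have hz : ¬ covered F1 z := by
        rw [hcov]
        grind
      have hsub : K ∪ F1 ⊆ K ∪ F := by
        rintro e (he | he | he)
        · exact Or.inl he
        · subst he; exact Or.inl hxy
        · exact Or.inr he.1
      obtain ⟨h1, h2⟩ := ih F1 (z :: R) z b (by simp at hl ⊢; omega) hm hQ' rfl hb' hz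
      rw [hcard] at h1 h2
      constructor
      · intro ho
        obtain ⟨M, hM, h⟩ := h1 (by simp at ho ⊢; omega)
        exact ⟨M, hM.trans hsub, h⟩
      · intro ho hbF
        obtain ⟨M, hM, h⟩ := h2 (by simp at ho ⊢; omega) (by
          rw [hcov]
          have : b ∈ z :: R := List.mem_of_getLast? hb'
          grind)
        exact ⟨M, hM.trans hsub, h⟩

theorem er_of_or {K F : Set (Sym2 V)} (hF : IsMatching F) {x y : V} (hx : x ∈ ORset K F)
    (hxy : s(x, y) ∈ F) : y ∈ ERset K F := by
  obtain ⟨p, a, hp, hpa, ha, hpx, hl⟩ := mem_ORset.mp hx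
  have hne := hp.1
  have hpos : 0 < p.length := List.length_pos_iff.mpr hne
  have hlast : p[p.length - 1] = x := by
    rw [List.getLast?_eq_getElem?] at hpx
    grind
  have hhead : p[0] = a := by
    rw [List.head?_eq_getElem?] at hpa
    grind
  have hyx : s(y, x) ∈ F := by rwa [Sym2.eq_swap]
  have hinj : ∀ i j (hi : i < p.length) (hj : j < p.length), p[i] = p[j] → i = j := by
    intro i j hi hj h
    exact (List.Nodup.getElem_inj_iff hp.2.1).mp h
  have hyp : y ∉ p := by
    intro h
    obtain ⟨i, hi, rfl⟩ := List.getElem_of_mem h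
    by_cases h0 : i = 0
    · subst h0
      apply ha
      rw [← hhead]
      exact ⟨_, hxy, Sym2.mem_mk_right _ _⟩
    · by_cases hodd : i % 2 = 1
      · have hil : i ≠ p.length - 1 := by
          rintro rfl
          exact hF.ne hxy hlast.symm
        have h1 := hp.2.2 i (by omega)
        rw [if_neg (by omega)] at h1
        have h2 := hF.uniq h1 hyx
        rw [← hlast] at h2
        have := hinj _ _ _ _ h2
        omega
      · have h1 := hp.2.2 (i - 1) (by omega)
        rw [if_neg (by omega), Sym2.eq_swap] at h1
        have e : i - 1 + 1 = i := by omega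
        simp only [e] at h1
        have h2 := hF.uniq h1 hyx
        rw [← hlast] at h2
        have := hinj _ _ _ _ h2
        omega
  refine mem_ERset.mpr ⟨p ++ [y], a, ⟨by simp, ?_, ?_⟩, ?_, ha, by simp, ?_⟩
  · have := hp.2.1
    grind
  · intro i hi
    by_cases hlt : i + 1 < p.length
    · have := hp.2.2 i hlt
      grind
    · simp at hi
      have e : i = p.length - 1 := by omega
      rw [if_neg (by omega)]
      subst e
      grind
  · rw [List.head?_append_of_ne_nil _ hne, hpa]
  · simp; omega

theorem or_of_er {K F : Set (Sym2 V)} {x : V} (hx : x ∈ ERset K F) :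
    ¬ covered F x ∨ ∃ y ∈ ORset K F, s(x, y) ∈ F := by
  obtain ⟨p, a, hp, hpa, ha, hpx, hl⟩ := mem_ERset.mp hx
  rcases List.eq_nil_or_concat' p with h | ⟨q, z, h⟩
  · exact absurd h hp.1
  · rcases List.eq_nil_or_concat' q with h' | ⟨r, y, h'⟩
    · left
      subst h' h
      simp at hpa hpx
      rw [← hpx, hpa]; exact ha
    · right
      subst h' h
      simp at hpx
      subst hpx
      refine ⟨y, mem_ORset.mpr ⟨r ++ [y], a, hp.pre (by simp), ?_, ha, by simp, ?_⟩, ?_⟩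
      · rw [List.head?_append_of_ne_nil _ (by simp)] at hpa
        exact hpa
      · simp at hl ⊢; omega
      · have := hp.2.2 r.length (by simp)
        simp at hl
        rw [if_neg (by omega), Sym2.eq_swap] at this
        simpa using this

theorem er_of_uncovered {K F : Set (Sym2 V)} {x : V} (hx : ¬ covered F x) : x ∈ ERset K F :=
  mem_ERset.mpr ⟨[x], x, ⟨by simp, by simp, fun i hi => by simp at hi⟩, rfl, hx, rfl, by simp⟩

theorem or_covered [Fintype V] {E F : Set (Sym2 V)} (hF : IsMaxMatching E F) {x : V}
    (hx : x ∈ ORset (E \ F) F) : covered F x := by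
  by_contra hc
  obtain ⟨p, a, hp, hpa, ha, hpx, hl⟩ := mem_ORset.mp hx
  obtain ⟨M, hM, hm, hcard⟩ := (switch p.length F p a x le_rfl hF.2.1 hp hpa hpx ha).2 hl hc
  have := hF.2.2 M (hM.trans (Set.union_subset Set.sdiff_subset hF.1)) hm
  omega

theorem ORset_mono {K K' F : Set (Sym2 V)} (h : K ⊆ K') : ORset K F ⊆ ORset K' F := by
  intro x hx
  obtain ⟨p, a, hp, h'⟩ := mem_ORset.mp hx
  exact mem_ORset.mpr ⟨p, a, hp.mono h subset_rfl, h'⟩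

theorem mem_edgesIn {F : Set (Sym2 V)} {C : Set V} {x y : V} :
    s(x, y) ∈ edgesIn F C ↔ s(x, y) ∈ F ∧ x ∈ C ∧ y ∈ C := by
  simp [edgesIn]

theorem mate_both {K F : Set (Sym2 V)} (hF : IsMatching F) {x y : V} (hx : x ∈ ORset K F)
    (hx' : x ∈ ERset K F) (hxy : s(x, y) ∈ F) : y ∈ ORset K F ∧ y ∈ ERset K F := by
  refine ⟨?_, er_of_or hF hx hxy⟩
  rcases or_of_er hx' with h | ⟨z, hz, hxz⟩
  · exact absurd ⟨_, hxy, Sym2.mem_mk_left _ _⟩ h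
  · rwa [hF.uniq hxy hxz]

theorem root_uncov {K F : Set (Sym2 V)} (hF : IsMatching F) {x : V} (hx : x ∉ ORset K F)
    (hx' : x ∈ ERset K F) : ¬ covered (edgesIn F (ERset K F)) x := by
  rw [covered_iff']
  rintro ⟨y, hy⟩
  obtain ⟨hxy, -, hyD⟩ := mem_edgesIn.mp hy
  rcases or_of_er hx' with h | ⟨z, hz, hxz⟩
  · exact absurd ⟨_, hxy, Sym2.mem_mk_left _ _⟩ h
  · rw [← hF.uniq hxy hxz] at hz
    rw [Sym2.eq_swap] at hxy
    exact hx (mate_both hF hz hyD hxy).1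

theorem lemmaX [Fintype V] {E F K' M : Set (Sym2 V)} (hF : IsMaxMatching E F) (hK : E \ F ⊆ K')
    (hM : IsMatching M) (hMs : M ⊆ edgesIn (K' ∪ F) (ERset (E \ F) F))
    (hlt : (edgesIn F (ERset (E \ F) F)).ncard < M.ncard) :
    ∃ r, r ∉ ORset (E \ F) F ∧ r ∈ ORset K' F := by
  set D := ERset (E \ F) F with hD
  have hsub : edgesIn F D ⊆ F := fun e he => he.1
  obtain ⟨Q, a, b, hQ, hQe, hQa, hQb, ha, hb⟩ :=
    berge hM _ (edgesIn F D) (hF.2.1.mono hsub) hlt le_rfl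
  have hQD : ∀ x ∈ Q, x ∈ D := by
    intro x hx
    obtain ⟨y, -, hy⟩ := hQ.mem_edge hQe hx
    exact (mem_edgesIn.mp (hMs hy.1)).2.1
  have hQ' : AltPath K' F Q := by
    apply hQ.mono _ hsub
    rintro e ⟨he, heF⟩
    rcases (hMs he).1 with h | h
    · exact h
    · exact absurd ⟨h, (hMs he).2⟩ heF
  have hroot : ∀ x ∈ D, ¬ covered (edgesIn F D) x → x ∉ ORset (E \ F) F := by
    intro x hxD hx hxO
    obtain ⟨y, hy⟩ := (covered_iff' _ _).mp (or_covered hF hxO)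
    exact hx ⟨_, mem_edgesIn.mpr ⟨hy, hxD, (mate_both hF.2.1 hxO hxD hy).2⟩, Sym2.mem_mk_left _ _⟩
  have haQ : a ∈ Q := List.mem_of_head? hQa
  have hbQ : b ∈ Q := List.mem_of_getLast? hQb
  obtain ⟨T, u, hT, hTu, hu, hTa, hTl⟩ := mem_ERset.mp (hQD a haQ)
  obtain ⟨P, hP, hPh, hPe, hPl⟩ := first_hit (hT.mono hK subset_rfl) hQ' hQe
    ⟨a, List.mem_of_getLast? hTa, haQ⟩
  rcases hPl with h | h
  · exact ⟨a, hroot a (hQD a haQ) ha, mem_ORset.mpr ⟨P, u, hP, hPh.trans hTu, hu, h.trans hQa, hPe⟩⟩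
  · exact ⟨b, hroot b (hQD b hbQ) hb, mem_ORset.mpr ⟨P, u, hP, hPh.trans hTu, hu, h.trans hQb, hPe⟩⟩

theorem edgesIn_max [Fintype V] {E F : Set (Sym2 V)} (hF : IsMaxMatching E F) :
    IsMaxMatching (edgesIn E (ERset (E \ F) F)) (edgesIn F (ERset (E \ F) F)) := by
  refine ⟨fun e he => ⟨hF.1 he.1, he.2⟩, hF.2.1.mono (fun e he => he.1), fun M hM hm => ?_⟩
  by_contra hlt
  obtain ⟨r, h1, h2⟩ := lemmaX (K' := E \ F) hF subset_rfl hm (fun e he => ⟨by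
    rw [Set.sdiff_union_self]; exact Or.inl (hM he).1, (hM he).2⟩) (by omega)
  exact h1 h2

theorem er_missed [Fintype V] {E F : Set (Sym2 V)} (hF : IsMaxMatching E F) {x : V}
    (hx : x ∈ ERset (E \ F) F) :
    ∃ N, IsMaxMatching (edgesIn E (ERset (E \ F) F)) N ∧ ¬ covered N x := by
  set D := ERset (E \ F) F with hD
  have hmax := edgesIn_max hF
  rw [← hD] at hmax
  obtain ⟨p, u, hp, hpu, hu, hpx, hpl⟩ := mem_ERset.mp hx
  have claim : ∀ (n : ℕ) (p : List V) (x : V), p.length ≤ n → AltPath (E \ F) F p →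
      p.head? = some u → p.getLast? = some x → p.length % 2 = 1 →
      ∃ q r, AltPath (edgesIn (E \ F) D) (edgesIn F D) q ∧ q.head? = some r ∧
        ¬ covered (edgesIn F D) r ∧ q.getLast? = some x ∧ q.length % 2 = 1 ∧ ∀ y ∈ q, y ∈ p := by
    intro n
    induction n with
    | zero =>
      intro p x h1 h2
      exact absurd (by simpa using h1) h2.1
    | succ n ih =>
      intro p x hpn hp hpu hpx hpl
      have hxD : x ∈ D := mem_ERset.mpr ⟨p, u, hp, hpu, hu, hpx, hpl⟩
      by_cases hxO : x ∈ ORset (E \ F) F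
      · rcases List.eq_nil_or_concat' p with h | ⟨q, z, h⟩
        · exact absurd h hp.1
        rcases List.eq_nil_or_concat' q with h' | ⟨r, y, h'⟩
        · exfalso
          subst h' h
          simp at hpu hpx
          exact hu (hpu ▸ hpx ▸ or_covered hF hxO)
        subst h' h
        simp at hpx
        subst hpx
        simp at hpl
        have hr : r ≠ [] := by rintro rfl; simp at hpl
        obtain ⟨w, hw⟩ : ∃ w, r.getLast? = some w := ⟨_, List.getLast?_eq_some_getLast hr⟩
        have hpr : AltPath (E \ F) F r := AltPath.pre (b := [y]) (AltPath.pre (b := [z]) hp (by simp)) hr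
        have hru : r.head? = some u := by
          rw [List.head?_append_of_ne_nil _ (by simp), List.head?_append_of_ne_nil _ hr] at hpu
          exact hpu
        obtain ⟨q, c, hq, hqc, hc, hqw, hql, hqr⟩ := ih r w (by simp at hpn; omega) hpr hru hw hpl
        have hwD : w ∈ D := mem_ERset.mpr ⟨r, u, hpr, hru, hu, hw, by omega⟩
        have hrl : r[r.length - 1]? = some w := by rw [← List.getLast?_eq_getElem?]; exact hw
        have hwy : s(w, y) ∈ E \ F := by
          have := hp.2.2 (r.length - 1) (by simp only [List.length_append, List.length_cons]; omega)
          rw [if_pos (by omega)] at this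
          grind
        have hyz : s(y, z) ∈ F := by
          have := hp.2.2 r.length (by simp)
          rw [if_neg (by omega)] at this
          simpa using this
        have hyD : y ∈ D := by
          have hzy : s(z, y) ∈ F := by rwa [Sym2.eq_swap]
          exact (mate_both hF.2.1 hxO hxD hzy).2
        have hnd := hp.2.1
        have hqwl : q[q.length - 1]? = some w := by rw [← List.getLast?_eq_getElem?]; exact hqw
        refine ⟨q ++ [y, z], c, ⟨by simp, ?_, ?_⟩, ?_, hc, by simp, by simp; omega, ?_⟩
        · have := hq.2.1
          grind
        · intro i hi
          simp at hi
          by_cases h1 : i + 1 < q.length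
          · have := hq.2.2 i h1
            grind
          · by_cases h2 : i + 1 = q.length
            · rw [if_pos (by omega)]
              have e1 : (q ++ [y, z])[i] = w := by grind
              have e2 : (q ++ [y, z])[i + 1] = y := by grind
              rw [e1, e2]
              exact mem_edgesIn.mpr ⟨hwy, hwD, hyD⟩
            · rw [if_neg (by omega)]
              have h3 : i = q.length := by omega
              subst h3
              have e1 : (q ++ [y, z])[q.length] = y := by simp
              have e2 : (q ++ [y, z])[q.length + 1] = z := by simp
              rw [e1, e2]
              exact mem_edgesIn.mpr ⟨hyz, hyD, hxD⟩
        · rw [List.head?_append_of_ne_nil _ hq.1, hqc]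
        · grind
      · refine ⟨[x], x, ⟨by simp, by simp, fun i hi => by simp at hi⟩, rfl,
          root_uncov hF.2.1 hxO hxD, rfl, by simp, ?_⟩
        have := List.mem_of_getLast? hpx
        grind
  obtain ⟨q, r, hq, hqr, hr, hqx, hql, -⟩ := claim _ p x le_rfl hp hpu hpx hpl
  obtain ⟨N, hN, hm, hcard, hNx⟩ :=
    (switch q.length _ q r x le_rfl hmax.2.1 hq hqr hqx hr).1 hql
  refine ⟨N, ⟨?_, hm, ?_⟩, hNx⟩
  · refine hN.trans (Set.union_subset ?_ hmax.1)
    exact fun e he => ⟨he.1.1, he.2⟩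
  · rw [hcard]; exact hmax.2.2

/-- An odd step from `D` either stays in `D`, or lands in `OR`, or is enriching. -/
theorem step_out {K K' F : Set (Sym2 V)} (hK : K ⊆ K') {x y : V} (hx : x ∈ ERset K F)
    (hy : y ∉ ERset K F) (hxy : s(x, y) ∈ K') : y ∈ ORset K' F := by
  by_cases hyO : y ∈ ORset K F
  · exact ORset_mono hK hyO
  obtain ⟨p, a, hp, hpa, ha, hpx, hl⟩ := mem_ERset.mp hx
  have hpos : 0 < p.length := List.length_pos_iff.mpr hp.1
  have hyp : y ∉ p := by
    intro h
    obtain ⟨q, r, rfl⟩ := List.append_of_mem h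
    have h1 : AltPath K F (q ++ [y]) := AltPath.pre (b := r) (by simpa using hp) (by simp)
    have h2 : (q ++ [y]).head? = some a := by
      rw [← hpa]; cases q <;> simp
    by_cases hpar : q.length % 2 = 0
    · exact hy (mem_ERset.mpr ⟨_, a, h1, h2, ha, by simp, by simp; omega⟩)
    · exact hyO (mem_ORset.mpr ⟨_, a, h1, h2, ha, by simp, by simp; omega⟩)
  have hlast : p[p.length - 1]? = some x := by rw [← List.getLast?_eq_getElem?]; exact hpx
  refine mem_ORset.mpr ⟨p ++ [y], a, ⟨by simp, ?_, ?_⟩, ?_, ha, by simp, by simp; omega⟩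
  · have := hp.2.1
    grind
  · intro i hi
    simp at hi
    by_cases h1 : i + 1 < p.length
    · have := (hp.mono hK subset_rfl).2.2 i h1
      grind
    · rw [if_pos (by omega)]
      have e1 : (p ++ [y])[i] = x := by grind
      have e2 : (p ++ [y])[i + 1] = y := by grind
      rw [e1, e2]
      exact hxy
  · rw [List.head?_append_of_ne_nil _ hp.1, hpa]

theorem step_in [Fintype V] {E F K' : Set (Sym2 V)} (hF : IsMaxMatching E F) (hK : E \ F ⊆ K')
    (hOR : ORset K' F ⊆ ORset (E \ F) F) {x y : V} (hxy : s(x, y) ∈ K' ∪ F)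
    (hx : x ∈ ERset (E \ F) F) (hy : y ∈ ERset (E \ F) F) :
    Sim (edgesIn E (ERset (E \ F) F)) x y := by
  by_cases hne : x = y
  · exact Or.inl hne
  refine Or.inr fun M hM hMx => ?_
  by_contra hMy
  have hmax := edgesIn_max hF
  have hle := hM.2.2 _ hmax.1 hmax.2.1
  obtain ⟨r, h1, h2⟩ := lemmaX hF hK (hM.2.1.insert hne hMx hMy) (Set.insert_subset
    (mem_edgesIn.mpr ⟨hxy, hx, hy⟩) (fun e he => ⟨by
      by_cases h : e ∈ F
      · exact Or.inr h
      · exact Or.inl (hK ⟨(hM.1 he).1, h⟩), (hM.1 he).2⟩)) (by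
      rw [insert_ncard hMx]; omega)
  exact h1 (hOR h2)

theorem path_main [Fintype V] {E F : Set (Sym2 V)} (hF : IsMaxMatching E F)
    (p : List V) (hnd : p.Nodup)
    (hodd : ∀ i, ∀ h : i + 1 < p.length, i % 2 = 1 → s(p[i], p[i+1]) ∈ F)
    (heven : ∀ i, ∀ h : i + 1 < p.length, i % 2 = 0 →
      ORset (insert s(p[i], p[i+1]) (E \ F)) F ⊆ ORset (E \ F) F)
    (h0 : 0 < p.length) (he : p.length % 2 = 0) (hs : ¬ covered F p[0])
    (ht : ¬ covered F p[p.length - 1]) : False := by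
  set D := ERset (E \ F) F with hD
  set O := ORset (E \ F) F with hO
  have hstep : ∀ i (h : 2 * i + 1 < p.length), p[2 * i] ∈ D →
      (∃ j, ∃ hj : 2 * j < p.length, p[2 * j] ∈ D ∧ p[2 * j] ∉ O ∧
        Sim (edgesIn E D) p[2 * j] p[2 * i]) →
      p[2 * i + 1] ∈ O ∧ (p[2 * i + 1] ∈ D → ∃ j, ∃ hj : 2 * j < p.length, p[2 * j] ∈ D ∧
        p[2 * j] ∉ O ∧ Sim (edgesIn E D) p[2 * j] p[2 * i + 1]) := by
    intro i h hiD ⟨j, hj, hjD, hjO, hsim⟩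
    have hK' := heven (2 * i) h (by omega)
    by_cases h1D : p[2 * i + 1] ∈ D
    · have hs2 := step_in hF (Set.subset_insert _ _) hK' (Or.inl (Set.mem_insert _ _)) hiD h1D
      have hs3 : Sim (edgesIn E D) p[2 * j] p[2 * i + 1] :=
        hsim.trans hs2 (er_missed hF hiD)
      refine ⟨?_, fun _ => ⟨j, hj, hjD, hjO, hs3⟩⟩
      by_contra h1O
      rcases hs3 with h | h
      · have := (List.Nodup.getElem_inj_iff hnd).mp h
        omega
      · exact root_uncov hF.2.1 h1O h1D (h _ (edgesIn_max hF) (root_uncov hF.2.1 hjO hjD))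
    · exact ⟨hK' (step_out (Set.subset_insert _ _) hiD h1D (Set.mem_insert _ _)),
        fun h => absurd h h1D⟩
  have hinv : ∀ i (h : 2 * i + 1 < p.length), p[2 * i] ∈ D ∧
      (∃ j, ∃ hj : 2 * j < p.length, p[2 * j] ∈ D ∧ p[2 * j] ∉ O ∧
        Sim (edgesIn E D) p[2 * j] p[2 * i]) := by
    intro i
    induction i with
    | zero =>
      intro h
      have h1 : p[2 * 0] ∈ D := er_of_uncovered hs
      exact ⟨h1, 0, by omega, h1, fun h => hs (or_covered hF h), Or.inl rfl⟩
    | succ i ih =>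
      intro h
      obtain ⟨h1, h2⟩ := ih (by omega)
      obtain ⟨h3, h4⟩ := hstep i (by omega) h1 h2
      have hf : s(p[2 * i + 1], p[2 * (i + 1)]) ∈ F := hodd (2 * i + 1) (by omega) (by omega)
      have hnD : p[2 * (i + 1)] ∈ D := er_of_or hF.2.1 h3 hf
      refine ⟨hnD, ?_⟩
      by_cases h5 : p[2 * i + 1] ∈ D
      · obtain ⟨j, hj, hjD, hjO, hsim⟩ := h4 h5
        exact ⟨j, hj, hjD, hjO, hsim.trans (step_in hF subset_rfl subset_rfl (Or.inr hf) h5 hnD)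
          (er_missed hF h5)⟩
      · refine ⟨i + 1, by omega, hnD, fun h6 => h5 ?_, Or.inl rfl⟩
        rw [Sym2.eq_swap] at hf
        exact er_of_or hF.2.1 h6 hf
  obtain ⟨h1, h2⟩ := hinv (p.length / 2 - 1) (by omega)
  have h3 := (hstep _ (by omega) h1 h2).1
  have e : 2 * (p.length / 2 - 1) + 1 = p.length - 1 := by omega
  simp only [e] at h3
  exact ht (or_covered hF h3)

/-- main lemma: if `F` is a maximum matching of the graph `E` and `K = E \ F`,
then every `F`-augmenting `F`-alternating path (whose non-`F` edges need not lie in `E`)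
contains a non-`F` edge `e ∉ E` that is enriching: `OR(K ∪ {e}, F) ⊋ OR(K, F)`. -/
theorem stmt_15 {V : Type*} [Fintype V] (E F : Set (Sym2 V))
    (hE : ∀ e ∈ E, ¬ e.IsDiag) (hF : IsMaxMatching E F)
    (p : List V) (haug : Augmenting F p) :
    ∃ i, ∃ h : i + 1 < p.length, i % 2 = 0 ∧
      s(p[i]'(Nat.lt_of_succ_lt h), p[i+1]'h) ∉ E ∧
      ORset (E \ F) F ⊂
        ORset (insert s(p[i]'(Nat.lt_of_succ_lt h), p[i+1]'h) (E \ F)) F := by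
  by_contra hcon
  push Not at hcon
  obtain ⟨hp, ⟨-, hnd, halt⟩, heven, hs, ht⟩ := haug
  have h0 : 0 < p.length := List.length_pos_iff.mpr hp
  refine path_main hF p hnd (fun i h hi => (halt i h).2 hi) ?_ h0 (Nat.even_iff.mp heven) ?_ ?_
  · intro i h hi
    by_cases hmem : s(p[i], p[i+1]) ∈ E
    · have hm : s(p[i], p[i+1]) ∈ E \ F := ⟨hmem, (halt i h).1 hi⟩
      rw [Set.insert_eq_of_mem hm]
    · by_contra hns
      exact hcon i h hi hmem ⟨ORset_mono (Set.subset_insert _ _), hns⟩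
  · rwa [List.head_eq_getElem] at hs
  · rwa [List.getLast_eq_getElem] at ht
end

section
/- Let F be a maximum matching in a graph G (with vertex set possibly larger, i.e., paths may use non-edges of G), and let P be a family of F-augmenting F-alternating paths with |P| > 2|F|. Then there exists an F-augmenting F-alternating path whose non-F edges form a rainbow set for the family (E(P_i))_{P_i ∈ P}, i.e., each non-F edge comes from a distinct member of the family. -/
variable {V : Type*}

namespace MC

def flat (l : List (V × V)) : List V := l.flatMap (fun p => [p.1, p.2])
def rev (l : List (V × V)) : List (V × V) := l.reverse.map Prod.swap
def fin : V → List (V × V) → V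
  | u, [] => u
  | _, (p :: l) => fin p.2 l
def Ch (F K : Set (Sym2 V)) : V → List (V × V) → Prop
  | _, [] => True
  | u, (p :: l) => s(u, p.1) ∈ K ∧ s(p.1, p.2) ∈ F ∧ Ch F K p.2 l

@[simp] lemma flat_nil : flat ([] : List (V × V)) = [] := rfl
@[simp] lemma flat_cons (p : V × V) (l) : flat (p :: l) = p.1 :: p.2 :: flat l := rfl
@[simp] lemma flat_append (l l' : List (V × V)) : flat (l ++ l') = flat l ++ flat l' := by
  simp [flat]
@[simp] lemma rev_nil : rev ([] : List (V × V)) = [] := rfl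
@[simp] lemma rev_cons (p : V × V) (l) : rev (p :: l) = rev l ++ [(p.2, p.1)] := by
  simp [rev]; rfl
@[simp] lemma flat_rev (l : List (V × V)) : flat (rev l) = (flat l).reverse := by
  induction l with
  | nil => rfl
  | cons p l ih => simp [ih]
@[simp] lemma fin_nil (u : V) : fin u [] = u := rfl
@[simp] lemma fin_cons (u : V) (p l) : fin u (p :: l) = fin p.2 l := rfl
@[simp] lemma fin_append (u : V) (l l') : fin u (l ++ l') = fin (fin u l) l' := by
  induction l generalizing u with
  | nil => rfl
  | cons p l ih => simp [ih]
lemma fin_mem (u : V) (l) (h : l ≠ []) : fin u l ∈ flat l := by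
  induction l generalizing u with
  | nil => exact absurd rfl h
  | cons p l ih =>
    by_cases hl : l = []
    · subst hl; simp
    · have := ih p.2 hl
      simp [this]
lemma fin_mem' (u : V) (l) : fin u l ∈ u :: flat l := by
  by_cases h : l = []
  · subst h; simp
  · exact List.mem_cons_of_mem _ (fin_mem u l h)

variable {F K : Set (Sym2 V)}

@[simp] lemma Ch_nil (u : V) : Ch F K u [] := trivial
@[simp] lemma Ch_cons (u : V) (p l) : Ch F K u (p :: l) ↔
  s(u, p.1) ∈ K ∧ s(p.1, p.2) ∈ F ∧ Ch F K p.2 l := Iff.rfl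
@[simp] lemma Ch_append (u : V) (l l') :
    Ch F K u (l ++ l') ↔ Ch F K u l ∧ Ch F K (fin u l) l' := by
  induction l generalizing u with
  | nil => simp
  | cons p l ih => simp [ih, and_assoc]
lemma Ch.mono {K' : Set (Sym2 V)} (hK : K ⊆ K') {u : V} {l} (h : Ch F K u l) : Ch F K' u l := by
  induction l generalizing u with
  | nil => simp
  | cons p l ih => exact ⟨hK h.1, h.2.1, ih h.2.2⟩
lemma Ch.rev {u y : V} {l} (h : Ch F K u l) (hy : s(y, fin u l) ∈ K) :
    Ch F K y (rev l) ∧ s(fin y (rev l), u) ∈ K := by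
  induction l generalizing u with
  | nil => simpa using hy
  | cons p l ih =>
    obtain ⟨h1, h2⟩ := ih h.2.2 hy
    obtain ⟨h3, h4, -⟩ := h
    refine ⟨?_, ?_⟩
    · simp only [rev_cons, Ch_append, Ch_cons, Ch_nil, and_true]
      exact ⟨h1, h2, by rwa [Sym2.eq_swap]⟩
    · simp only [rev_cons, fin_append, fin_cons, fin_nil]
      rwa [Sym2.eq_swap]
lemma Ch.mate {u : V} {l} (h : Ch F K u l) {v : V} (hv : v ∈ flat l) :
    ∃ w ∈ flat l, s(v, w) ∈ F := by
  induction l generalizing u with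
  | nil => simp at hv
  | cons p l ih =>
    obtain ⟨h3, h4, h5⟩ := h
    simp only [flat_cons, List.mem_cons] at hv
    rcases hv with rfl | rfl | hv
    · exact ⟨p.2, by simp, h4⟩
    · exact ⟨p.1, by simp, by rwa [Sym2.eq_swap]⟩
    · obtain ⟨w, hw, h⟩ := ih h5 hv
      exact ⟨w, by simp [hw], h⟩

lemma mate_unique (hF : IsMatching F) {a b c : V} (h1 : s(a, b) ∈ F) (h2 : s(a, c) ∈ F) :
    b = c := by
  by_contra hne
  refine hF.2 _ h1 _ h2 ?_ a (by simp) (by simp)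
  intro h
  simp at h
  grind

/-- list built from an alternating chain -/
lemma final_idx {u t : V} {l} (h : Ch F K u l) (ht : s(fin u l, t) ∈ K) :
    ∀ i, ∀ hi : i + 1 < (u :: flat l ++ [t]).length,
      (i % 2 = 0 → s((u :: flat l ++ [t])[i]'(Nat.lt_of_succ_lt hi),
        (u :: flat l ++ [t])[i+1]'hi) ∈ K) ∧
      (i % 2 = 1 → s((u :: flat l ++ [t])[i]'(Nat.lt_of_succ_lt hi),
        (u :: flat l ++ [t])[i+1]'hi) ∈ F) := by
  induction l generalizing u with
  | nil =>
    intro i hi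
    simp at hi
    subst hi
    simpa using ht
  | cons p l ih =>
    intro i hi
    obtain ⟨h3, h4, h5⟩ := h
    match i with
    | 0 => simpa using h3
    | 1 => simpa using h4
    | i + 2 =>
      have := ih h5 ht i (by simp at hi ⊢; omega)
      simpa using this

lemma flat_length (l : List (V × V)) : (flat l).length = 2 * l.length := by
  induction l with
  | nil => rfl
  | cons p l ih => simp [ih]; omega

lemma final {u t : V} {l} (hK : ∀ e ∈ K, e ∉ F) (h : Ch F K u l) (ht : s(fin u l, t) ∈ K)
    (hu : ¬ covered F u) (ht' : ¬ covered F t) (hn : (u :: flat l ++ [t]).Nodup) :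
    Augmenting F (u :: flat l ++ [t]) ∧ pathKEdges (u :: flat l ++ [t]) ⊆ K := by
  have key := final_idx h ht
  refine ⟨⟨by simp, ⟨by simp, hn, ?_⟩, ?_, by simpa using hu, by simpa using ht'⟩, ?_⟩
  · intro i hi
    exact ⟨fun h0 => hK _ ((key i hi).1 h0), (key i hi).2⟩
  · simp only [List.cons_append, List.length_cons, List.length_append, List.length_nil,
      flat_length]
    exact ⟨l.length + 1, by omega⟩
  · rintro e ⟨i, hi, h0, rfl⟩
    exact (key i hi).1 h0

structure St (F K : Set (Sym2 V)) (D : Set V) (β ρ : V → V) (L : V → List (V × V)) : Prop where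
  dU : ∀ u, ¬ covered F u → u ∈ D
  dβ : ∀ x ∈ D, β x ∈ D ∧ β (β x) = β x
  closed : ∀ x ∈ D, x ≠ β x → ∃ m ∈ D, s(x, m) ∈ F ∧ β m = β x
  root : ∀ x ∈ D, ¬ covered F (ρ x)
  ch : ∀ x ∈ D, Ch F K (ρ x) (L x)
  nd : ∀ x ∈ D, (ρ x :: flat (L x)).Nodup
  en : ∀ x ∈ D, fin (ρ x) (L x) = x
  pre : ∀ x ∈ D, ∃ R, L x = L (β x) ++ R ∧ ρ x = ρ (β x) ∧ ∀ v ∈ flat R, v ∈ D ∧ β v = β x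
  base : ∀ x ∈ D, β x = x → L x = [] ∨
    ∃ z ∈ D, ∃ a, a ∉ D ∧ L x = L z ++ [(a, x)] ∧ ρ x = ρ z

variable {D : Set V} {β ρ : V → V} {L : V → List (V × V)}

lemma St.mono {K' : Set (Sym2 V)} (hK : K ⊆ K') (S : St F K D β ρ L) : St F K' D β ρ L :=
  { S with ch := fun x hx => (S.ch x hx).mono hK }

lemma St.snd (S : St F K D β ρ L) : ∀ n, ∀ y ∈ D, (L y).length = n → ∀ p ∈ L y, p.2 ∈ D := by
  intro n
  induction n using Nat.strong_induction_on with
  | _ n ih =>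
  intro y hy hn p hp
  obtain ⟨R, hR, hρ, hR'⟩ := S.pre y hy
  obtain ⟨hb, hbb⟩ := S.dβ y hy
  rw [hR, List.mem_append] at hp
  rcases hp with hp | hp
  · rcases S.base _ hb hbb with h | ⟨z, hz, a, ha, h, -⟩
    · simp [h] at hp
    · rw [h] at hp hR
      simp only [List.mem_append, List.mem_singleton] at hp
      rcases hp with hp | rfl
      · refine ih (L z).length ?_ z hz rfl p hp
        rw [← hn, hR]; simp
      · exact hb
  · exact (hR' p.2 (by rw [flat, List.mem_flatMap]; exact ⟨p, hp, by simp⟩)).1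

lemma St.pfx (S : St F K D β ρ L) : ∀ n, ∀ y ∈ D, (L y).length = n →
    ∀ v ∈ ρ y :: flat (L y), ∃ b ∈ D, β b = b ∧ (∃ T, L y = L b ++ T) ∧ ρ y = ρ b ∧
      (v ∈ D ∧ β v = b ∨ v ∉ D ∧ s(v, b) ∈ F) := by
  intro n
  induction n using Nat.strong_induction_on with
  | _ n ih =>
  intro y hy hn v hv
  obtain ⟨R, hR, hρ, hR'⟩ := S.pre y hy
  obtain ⟨hb, hbb⟩ := S.dβ y hy
  have own : v ∈ D → β v = β y → ∃ b ∈ D, β b = b ∧ (∃ T, L y = L b ++ T) ∧ ρ y = ρ b ∧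
      (v ∈ D ∧ β v = b ∨ v ∉ D ∧ s(v, b) ∈ F) :=
    fun h1 h2 => ⟨β y, hb, hbb, ⟨R, hR⟩, hρ, Or.inl ⟨h1, h2⟩⟩
  rw [hR, flat_append, ← List.cons_append, List.mem_append] at hv
  rcases hv with hv | hv
  · have hen := S.en _ hb
    have hch := S.ch _ hb
    rcases S.base _ hb hbb with h | ⟨z, hz, a, ha, h, hρz⟩
    · rw [h] at hv hen
      simp at hv hen
      rw [hρ, hen] at hv
      subst hv
      exact own hb hbb
    · rw [h] at hv hch
      rw [flat_append, ← List.cons_append, List.mem_append] at hv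
      rcases hv with hv | hv
      · obtain ⟨b, h1, h2, ⟨T, h3⟩, h4, h5⟩ := ih (L z).length
          (by rw [← hn, hR, h]; simp) z hz rfl v (by rwa [hρ, hρz] at hv)
        refine ⟨b, h1, h2, ⟨T ++ [(a, β y)] ++ R, ?_⟩, ?_, h5⟩
        · rw [hR, h, h3]; simp
        · rw [hρ, hρz, h4]
      · simp at hv
        rcases hv with rfl | rfl
        · refine ⟨β y, hb, hbb, ⟨R, hR⟩, hρ, Or.inr ⟨ha, ?_⟩⟩
          simp at hch
          exact hch.2.2
        · exact own hb hbb
  · exact own (hR' v hv).1 (hR' v hv).2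

def Half (D : Set V) (β : V → V) (X : List (V × V)) : Prop :=
  (X = [] ∨ ∃ v ∈ flat X, v ∉ D) ∧ ∀ v ∈ flat X, v ∈ D → β v ∈ flat X

def Meet (D : Set V) (β ρ : V → V) (L : V → List (V × V)) (x y : V) : Prop :=
  List.Disjoint (ρ x :: flat (L x)) (ρ y :: flat (L y)) ∨
  ∃ z z' X Y, z ∈ D ∧ z' ∈ D ∧ β z = β z' ∧ L x = L z ++ X ∧ L y = L z' ++ Y ∧
    ρ x = ρ z ∧ ρ y = ρ z' ∧
    List.Disjoint (flat X) (ρ y :: flat (L y)) ∧ List.Disjoint (flat Y) (ρ x :: flat (L x)) ∧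
    Half D β X ∧ Half D β Y

lemma Meet.symm {x y : V} (h : Meet D β ρ L x y) : Meet D β ρ L y x := by
  rcases h with h | ⟨z, z', X, Y, h1, h2, h3, h4, h5, h6, h7, h8, h9, h10, h11⟩
  · exact Or.inl h.symm
  · exact Or.inr ⟨z', z, Y, X, h2, h1, h3.symm, h5, h4, h7, h6, h9, h8, h11, h10⟩

lemma St.not_mem (hF : IsMatching F) (S : St F K D β ρ L) {x y t : V} (hx : x ∈ D) (hy : y ∈ D)
    (hne : β x ≠ β y) (hlen : (L (β y)).length ≤ (L (β x)).length)
    (ht : t ∈ D ∧ β t = β x ∨ t ∉ D ∧ s(t, β x) ∈ F) (hty : t ∈ ρ y :: flat (L y)) : False := by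
  obtain ⟨b, hb, hbb, ⟨T, hT⟩, hρ, h⟩ := S.pfx _ y hy rfl t hty
  have hbx : b = β x := by
    rcases ht with ⟨h1, h2⟩ | ⟨h1, h2⟩
    · rcases h with h | h
      · rw [← h.2, h2]
      · exact absurd h1 h.1
    · rcases h with h | h
      · exact absurd h.1 h1
      · exact mate_unique hF h.2 h2
  subst hbx
  obtain ⟨R, hR, hρ', hR'⟩ := S.pre y hy
  have hpre : L (β y) <+: L (β x) := by
    apply List.prefix_of_prefix_length_le (l₃ := L y) _ _ hlen
    · exact ⟨R, hR.symm⟩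
    · exact ⟨T, hT.symm⟩
  obtain ⟨Q, hQ⟩ := hpre
  have e1 := S.en _ hb
  have e2 := S.en _ (S.dβ y hy).1
  by_cases hQ0 : Q = []
  · subst hQ0
    rw [List.append_nil] at hQ
    rw [← hQ, ← hρ, hρ', e2] at e1
    exact hne e1.symm
  · have : R = Q ++ T := by
      rw [hT, ← hQ, List.append_assoc] at hR
      exact (List.append_cancel_left hR).symm
    have h3 : β x ∈ flat R := by
      rw [this, flat_append, List.mem_append]
      left
      rw [← hQ, fin_append] at e1
      have h4 := fin_mem (fin (ρ (β x)) (L (β y))) Q hQ0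
      rwa [e1] at h4
    have := (hR' _ h3).2
    rw [hbb] at this
    exact hne this

lemma St.meet (hF : IsMatching F) (S : St F K D β ρ L) : ∀ n, ∀ x ∈ D, ∀ y ∈ D,
    (L x).length + (L y).length = n → Meet D β ρ L x y := by
  intro n
  induction n using Nat.strong_induction_on with
  | _ n ih =>
  have main : ∀ x ∈ D, ∀ y ∈ D, (L x).length + (L y).length = n →
      (L (β y)).length ≤ (L (β x)).length → Meet D β ρ L x y := by
    intro x hx y hy hn hlen
    by_cases hne : β x = β y
    · exact Or.inr ⟨x, y, [], [], hx, hy, hne, by simp, by simp, rfl, rfl, by simp, by simp,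
        ⟨Or.inl rfl, by simp⟩, ⟨Or.inl rfl, by simp⟩⟩
    have nm := fun t => S.not_mem (t := t) hF hx hy hne hlen
    obtain ⟨R, hR, hρ, hR'⟩ := S.pre x hx
    obtain ⟨hb, hbb⟩ := S.dβ x hx
    have hch := S.ch _ hb
    have hen := S.en _ hb
    have rdis : ∀ v ∈ flat R, v ∈ ρ y :: flat (L y) → False :=
      fun v hv => nm v (Or.inl (hR' v hv))
    have bdis : β x ∈ ρ y :: flat (L y) → False := nm _ (Or.inl ⟨hb, hbb⟩)
    rcases S.base _ hb hbb with h | ⟨z, hz, a, ha, h, hρz⟩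
    · left
      rw [h] at hR hen
      simp only [fin_nil] at hen
      rw [hR, hρ, hen]
      intro v hv
      simp only [List.nil_append, List.mem_cons] at hv
      rcases hv with rfl | hv
      · exact bdis
      · exact rdis v hv
    · have haF : s(a, β x) ∈ F := by
        rw [h] at hch; simp at hch; exact hch.2.2
      have adis := nm a (Or.inr ⟨ha, haF⟩)
      have tail : List.Disjoint (flat ((a, β x) :: R)) (ρ y :: flat (L y)) := by
        intro v hv
        simp only [flat_cons, List.mem_cons] at hv
        rcases hv with rfl | rfl | hv
        · exact adis
        · exact bdis
        · exact rdis v hv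
      have hLx : L x = L z ++ (a, β x) :: R := by rw [hR, h]; simp
      have hρx : ρ x = ρ z := by rw [hρ, hρz]
      have hlt : (L z).length + (L y).length < n := by
        rw [← hn, hLx]; simp
      rcases ih _ hlt z hz y hy rfl with hd |
        ⟨w, w', X, Y, h1, h2, h3, h4, h5, h6, h7, h8, h9, h10, h11⟩
      · left
        rw [hLx, hρx, flat_append, ← List.cons_append]
        exact List.disjoint_append_left.2 ⟨hd, tail⟩
      · right
        refine ⟨w, w', X ++ (a, β x) :: R, Y, h1, h2, h3, ?_, h5, by rw [hρx, h6], h7, ?_, ?_,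
          ⟨Or.inr ⟨a, by simp, ha⟩, ?_⟩, h11⟩
        · rw [hLx, h4]; simp
        · rw [flat_append]
          exact List.disjoint_append_left.2 ⟨h8, tail⟩
        · rw [hLx, hρx, flat_append, ← List.cons_append]
          refine List.disjoint_append_right.2 ⟨h9, fun v hv hv' => tail hv' ?_⟩
          rw [h5, flat_append]
          simp [hv]
        · intro v hv hvD
          rw [flat_append, List.mem_append] at hv ⊢
          rcases hv with hv | hv
          · exact Or.inl (h10.2 v hv hvD)
          · right
            simp only [flat_cons, List.mem_cons] at hv ⊢
            rcases hv with rfl | rfl | hv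
            · exact absurd hvD ha
            · right; left; exact hbb
            · right; left; exact (hR' v hv).2
  intro x hx y hy hn
  rcases le_total (L (β y)).length (L (β x)).length with h | h
  · exact main x hx y hy hn h
  · exact (main y hy x hx (by omega) h).symm

lemma St.step1 (S : St F K D β ρ L) (hF : IsMatching F) {x y w : V} (hx : x ∈ D) (hy : y ∉ D)
    (hw : w ∉ D) (hxy : s(x, y) ∈ K) (hyw : s(y, w) ∈ F) :
    ∃ β' ρ' L', St F K (insert w D) β' ρ' L' := by
  classical
  have hwy : w ≠ y := by
    rintro rfl
    exact hF.1 _ hyw (by simp)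
  have hne : ∀ v ∈ D, v ≠ w := fun v hv h => hw (h ▸ hv)
  have nin : ∀ t, t ∉ D → (∀ b ∈ D, s(t, b) ∉ F) → t ∉ ρ x :: flat (L x) := by
    intro t h1 h2 h3
    obtain ⟨b, hb, -, -, -, h | h⟩ := S.pfx _ x hx rfl t h3
    · exact h1 h.1
    · exact h2 b hb h.2
  have hy' : y ∉ ρ x :: flat (L x) := nin y hy (fun b hb h => hw (mate_unique hF hyw h ▸ hb))
  have hw' : w ∉ ρ x :: flat (L x) :=
    nin w hw (fun b hb h => hy (mate_unique hF (by rwa [Sym2.eq_swap]) h ▸ hb))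
  refine ⟨Function.update β w w, Function.update ρ w (ρ x),
    Function.update L w (L x ++ [(y, w)]), ?_⟩
  constructor
  · exact fun u hu => Or.inr (S.dU u hu)
  · rintro v (rfl | hv)
    · simp
    · have := S.dβ v hv
      simp [Function.update_of_ne (hne v hv), Function.update_of_ne (hne _ this.1), this]
  · rintro v (rfl | hv) h
    · simp at h
    · rw [Function.update_of_ne (hne v hv)] at h ⊢
      obtain ⟨m, h1, h2, h3⟩ := S.closed v hv h
      exact ⟨m, Or.inr h1, h2, by rwa [Function.update_of_ne (hne m h1)]⟩
  · rintro v (rfl | hv)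
    · simpa using S.root x hx
    · simpa [Function.update_of_ne (hne v hv)] using S.root v hv
  · rintro v (rfl | hv)
    · simp [S.ch x hx, S.en x hx, hxy, hyw]
    · simpa [Function.update_of_ne (hne v hv)] using S.ch v hv
  · rintro v (rfl | hv)
    · simp only [Function.update_self, flat_append, flat_cons, flat_nil]
      rw [← List.cons_append, List.nodup_append]
      refine ⟨S.nd x hx, by simpa using hwy.symm, ?_⟩
      intro a ha b hb
      simp at hb
      rintro rfl
      rcases hb with rfl | rfl
      · exact hy' ha
      · exact hw' ha
    · rw [Function.update_of_ne (hne v hv), Function.update_of_ne (hne v hv)]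
      exact S.nd v hv
  · rintro v (rfl | hv)
    · simp
    · rw [Function.update_of_ne (hne v hv), Function.update_of_ne (hne v hv)]
      exact S.en v hv
  · rintro v (rfl | hv)
    · exact ⟨[], by simp, by simp, by simp⟩
    · obtain ⟨R, h1, h2, h3⟩ := S.pre v hv
      have hb := hne _ (S.dβ v hv).1
      rw [Function.update_of_ne (hne v hv), Function.update_of_ne (hne v hv),
        Function.update_of_ne (hne v hv), Function.update_of_ne hb, Function.update_of_ne hb]
      refine ⟨R, h1, h2, fun t ht => ⟨Or.inr (h3 t ht).1, ?_⟩⟩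
      rw [Function.update_of_ne (hne t (h3 t ht).1)]
      exact (h3 t ht).2
  · rintro v (rfl | hv) h
    · right
      refine ⟨x, Or.inr hx, y, ?_, ?_, ?_⟩
      · rintro (h | h)
        · exact hwy h.symm
        · exact hy h
      · simp [Function.update_of_ne (hne x hx)]
      · simp [Function.update_of_ne (hne x hx)]
    · rw [Function.update_of_ne (hne v hv)] at h
      rw [Function.update_of_ne (hne v hv), Function.update_of_ne (hne v hv)]
      rcases S.base v hv h with h | ⟨z, hz, a, ha, h1, h2⟩
      · exact Or.inl h
      · right
        refine ⟨z, Or.inr hz, a, ?_, ?_, ?_⟩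
        · rintro (h | h)
          · subst h
            have h3 := S.ch v hv
            rw [h1] at h3
            simp at h3
            exact hy (mate_unique hF (by rwa [Sym2.eq_swap] : s(a, y) ∈ F) h3.2.2 ▸ hv)
          · exact ha h
        · rwa [Function.update_of_ne (hne z hz)]
        · rwa [Function.update_of_ne (hne z hz)]

lemma St.aug (S : St F K D β ρ L) (hK : ∀ e ∈ K, e ∉ F) {x y : V} (hx : x ∈ D) (hy : y ∈ D)
    (hxy : s(x, y) ∈ K)
    (hd : List.Disjoint (ρ x :: flat (L x)) (ρ y :: flat (L y))) :
    ∃ q, Augmenting F q ∧ pathKEdges q ⊆ K := by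
  obtain ⟨h1, h2⟩ := (S.ch y hy).rev (y := x) (by rwa [S.en y hy])
  refine ⟨_, final (u := ρ x) (t := ρ y) (l := L x ++ rev (L y)) hK ?_ ?_ (S.root x hx)
    (S.root y hy) ?_⟩
  · rw [Ch_append, S.en x hx]
    exact ⟨S.ch x hx, h1⟩
  · rwa [fin_append, S.en x hx]
  · have : (ρ x :: flat (L x ++ rev (L y)) ++ [ρ y]) =
        (ρ x :: flat (L x)) ++ (ρ y :: flat (L y)).reverse := by simp
    rw [this, List.nodup_append']
    refine ⟨S.nd x hx, List.nodup_reverse.2 (S.nd y hy), ?_⟩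
    intro v h1 h2
    exact hd h1 (List.mem_reverse.1 h2)

lemma St.climb (S : St F K D β ρ L) {x z c : V} {X} (hx : x ∈ D) (hc : c ∈ D)
    (hcc : β c = c) (hcX : c ∈ flat X) (hX : L x = L z ++ X) (hρ : ρ x = ρ z) :
    ∃ Q, L c = L z ++ Q ∧ (∀ v ∈ flat Q, v ∈ flat X) ∧ ρ c = ρ z := by
  have hmem : c ∈ ρ x :: flat (L x) := by rw [hX]; simp [hcX]
  obtain ⟨b, hb, -, ⟨T, hT⟩, hρb, h | h⟩ := S.pfx _ x hx rfl c hmem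
  · rw [hcc] at h
    obtain ⟨-, rfl⟩ := h
    rcases le_total (L z).length (L c).length with hl | hl
    · obtain ⟨Q, hQ⟩ := List.prefix_of_prefix_length_le (l₁ := L z) (l₂ := L c) (l₃ := L x)
        ⟨X, hX.symm⟩ ⟨T, hT.symm⟩ hl
      refine ⟨Q, hQ.symm, ?_, by rw [← hρb, hρ]⟩
      have : X = Q ++ T := by
        rw [hT, ← hQ, List.append_assoc] at hX
        exact (List.append_cancel_left hX).symm
      intro v hv
      rw [this]; simp [hv]
    · exfalso
      obtain ⟨Q, hQ⟩ := List.prefix_of_prefix_length_le (l₁ := L c) (l₂ := L z) (l₃ := L x)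
        ⟨T, hT.symm⟩ ⟨X, hX.symm⟩ hl
      have hn := S.nd x hx
      rw [hX, flat_append, ← List.cons_append, List.nodup_append'] at hn
      refine hn.2.2 ?_ hcX
      have := fin_mem' (ρ c) (L c)
      rw [S.en c hc] at this
      rw [hρb, ← hQ, flat_append, ← List.cons_append, List.mem_append]
      exact Or.inl this
  · exact absurd hc h.1

lemma St.half (S : St F K D β ρ L) {x y z z' : V} {X Y} (hx : x ∈ D) (hy : y ∈ D)
    (hz' : z' ∈ D)
    (hX : L x = L z ++ X) (hY : L y = L z' ++ Y) (hρ' : ρ y = ρ z')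
    (hd : List.Disjoint (flat X) (ρ y :: flat (L y))) (hxy : s(y, x) ∈ K)
    {v : V} (hvX : v ∈ flat X) (hv : v ∉ D) :
    ∃ l R, l = L (β z') ++ R ∧ Ch F K (ρ (β z')) l ∧ (ρ (β z') :: flat l).Nodup ∧
      fin (ρ (β z')) l = v ∧
      ∀ t ∈ flat R, (t ∈ flat X ∨ t ∈ flat Y) ∨ (t ∈ D ∧ β t = β z') := by
  obtain ⟨p, hp, hvp⟩ := List.mem_flatMap.1 hvX
  have hp2 : p.2 ∈ D := S.snd _ x hx rfl p (by rw [hX]; simp [hp])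
  have hvp : v = p.1 := by
    simp at hvp
    rcases hvp with h | h
    · exact h
    · exact absurd (h ▸ hp2) hv
  obtain ⟨X1, X2, hX12⟩ := List.append_of_mem hp
  obtain ⟨R, hR, hρR, hR'⟩ := S.pre z' hz'
  have hcx := S.ch x hx
  have hex := S.en x hx
  rw [hX, hX12, ← List.append_assoc] at hcx hex
  rw [Ch_append] at hcx
  rw [fin_append] at hex
  obtain ⟨h1, -⟩ := hcx.2.rev (y := y) (by rwa [hex])
  have hsub : ∀ t ∈ flat (p :: X2), t ∈ flat X := by
    intro t ht
    rw [hX12, flat_append, List.mem_append]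
    exact Or.inr ht
  have hρy : ρ (β z') = ρ y := by rw [hρ', hρR]
  refine ⟨L y ++ rev (p :: X2), R ++ Y ++ rev (p :: X2), ?_, ?_, ?_, ?_, ?_⟩
  · rw [hY, hR]; simp
  · rw [hρy, Ch_append, S.en y hy]
    exact ⟨S.ch y hy, h1⟩
  · rw [hρy, flat_append, flat_rev, ← List.cons_append, List.nodup_append']
    refine ⟨S.nd y hy, List.nodup_reverse.2 ?_, ?_⟩
    · have hn := S.nd x hx
      rw [hX, hX12, ← List.append_assoc, flat_append, ← List.cons_append, List.nodup_append'] at hn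
      exact hn.2.1
    · intro t h2 h3
      exact hd (hsub t (List.mem_reverse.1 h3)) h2
  · simp [hvp]
  · intro t ht
    rw [flat_append, flat_append, flat_rev, List.mem_append, List.mem_append,
      List.mem_reverse] at ht
    rcases ht with (ht | ht) | ht
    · exact Or.inr (hR' t ht)
    · exact Or.inl (Or.inr ht)
    · exact Or.inl (Or.inl (hsub t ht))

lemma St.step2 (S : St F K D β ρ L) (hF : IsMatching F) (hK : ∀ e ∈ K, e ∉ F) {x y : V}
    (hx : x ∈ D) (hy : y ∈ D) (hne : β x ≠ β y) (hxy : s(x, y) ∈ K) :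
    (∃ q, Augmenting F q ∧ pathKEdges q ⊆ K) ∨
    ∃ D' β' ρ' L', (∃ v ∈ D', v ∉ D) ∧ D ⊆ D' ∧ St F K D' β' ρ' L' := by
  classical
  rcases S.meet hF _ x hx y hy rfl with hd |
    ⟨z, z', X, Y, hz, hz', hzz, hX, hY, hρx, hρy, hdX, hdY, hHX, hHY⟩
  · exact Or.inl (S.aug hK hx hy hxy hd)
  right
  obtain ⟨b, hbdef⟩ : ∃ b, b = β z := ⟨_, rfl⟩
  obtain ⟨hb, hbb⟩ := S.dβ z hz
  obtain ⟨T, hT⟩ : ∃ T : Set V, ∀ v, v ∈ T ↔ v ∈ flat X ∨ v ∈ flat Y :=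
    ⟨{v | v ∈ flat X ∨ v ∈ flat Y}, fun v => Iff.rfl⟩
  obtain ⟨R0, hR0, hρ0, hR0'⟩ := S.pre z hz
  obtain ⟨R0', hR0y, hρ0y, hR0y'⟩ := S.pre z' hz'
  rw [← hzz] at hR0y hρ0y hR0y'
  rw [← hbdef] at hb hbb hR0 hρ0 hR0' hR0y hρ0y hR0y'
  have hbfin := fin_mem' (ρ b) (L b)
  rw [S.en b hb] at hbfin
  have hbT : b ∉ T := by
    rw [hT]
    rintro (h | h)
    · refine hdX h ?_
      rw [hρy, hρ0y, hY, hR0y, List.append_assoc, flat_append, ← List.cons_append]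
      exact List.mem_append_left _ hbfin
    · refine hdY h ?_
      rw [hρx, hρ0, hX, hR0, List.append_assoc, flat_append, ← List.cons_append]
      exact List.mem_append_left _ hbfin
  have hTβ : ∀ v ∈ T, v ∈ D → β v ∈ T := by
    intro v hv hvD
    rw [hT] at hv ⊢
    exact hv.imp (fun h => hHX.2 v h hvD) (fun h => hHY.2 v h hvD)
  have hTm : ∀ v ∈ T, ∃ w ∈ T, s(v, w) ∈ F := by
    intro v hv
    rw [hT] at hv
    rcases hv with h | h
    · have hc := S.ch x hx
      rw [hX, Ch_append] at hc
      obtain ⟨w, hw, h'⟩ := hc.2.mate h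
      exact ⟨w, (hT w).2 (Or.inl hw), h'⟩
    · have hc := S.ch y hy
      rw [hY, Ch_append] at hc
      obtain ⟨w, hw, h'⟩ := hc.2.mate h
      exact ⟨w, (hT w).2 (Or.inr hw), h'⟩
  have hTm' : ∀ v ∈ T, ∀ w, s(v, w) ∈ F → w ∈ T := by
    intro v hv w hvw
    obtain ⟨w', h1, h2⟩ := hTm v hv
    rwa [mate_unique hF hvw h2]
  have hnew : ∃ v ∈ T, v ∉ D := by
    rcases hHX.1 with h | ⟨v, h1, h2⟩
    · rcases hHY.1 with h' | ⟨v, h1, h2⟩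
      · exfalso
        subst h h'
        rw [List.append_nil] at hX hY
        have e1 := S.en x hx
        have e2 := S.en y hy
        rw [hX, hρx, S.en z hz] at e1
        rw [hY, hρy, S.en z' hz'] at e2
        subst e1 e2
        exact hne hzz
      · exact ⟨v, (hT v).2 (Or.inr h1), h2⟩
    · exact ⟨v, (hT v).2 (Or.inl h1), h2⟩
  have hg : ∀ v, v ∈ T → v ∉ D → ∃ l R, l = L b ++ R ∧ Ch F K (ρ b) l ∧
      (ρ b :: flat l).Nodup ∧ fin (ρ b) l = v ∧ ∀ t ∈ flat R, t ∈ T ∨ (t ∈ D ∧ β t = b) := by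
    intro v hv hvD
    rw [hT] at hv
    rcases hv with h | h
    · obtain ⟨l, R, h1, h2, h3, h4, h5⟩ :=
        S.half hx hy hz' hX hY hρy hdX (by rwa [Sym2.eq_swap]) h hvD
      rw [← hzz, ← hbdef] at h1 h2 h3 h4 h5
      exact ⟨l, R, h1, h2, h3, h4, fun t ht => (h5 t ht).imp (fun h => (hT t).2 h) id⟩
    · obtain ⟨l, R, h1, h2, h3, h4, h5⟩ := S.half hy hx hz hY hX hρx hdY hxy h hvD
      rw [← hbdef] at h1 h2 h3 h4 h5
      exact ⟨l, R, h1, h2, h3, h4, fun t ht => (h5 t ht).imp (fun h => (hT t).2 h.symm) id⟩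
  choose! g R g1 g2 g3 g4 g5 using hg
  have hclimb : ∀ c ∈ D, β c = c → c ∈ T → ∃ Q, L c = L b ++ Q ∧ ρ c = ρ b ∧
      ∀ t ∈ flat Q, t ∈ T ∨ (t ∈ D ∧ β t = b) := by
    intro c hc hcc hcT
    rw [hT] at hcT
    rcases hcT with h | h
    · obtain ⟨Q, h1, h2, h3⟩ := S.climb hx hc hcc h hX hρx
      refine ⟨R0 ++ Q, by rw [h1, hR0, List.append_assoc], by rw [h3, hρ0], ?_⟩
      intro t ht
      rw [flat_append, List.mem_append] at ht
      rcases ht with ht | ht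
      · have := hR0' t ht
        exact Or.inr this
      · exact Or.inl ((hT t).2 (Or.inl (h2 t ht)))
    · obtain ⟨Q, h1, h2, h3⟩ := S.climb hy hc hcc h hY hρy
      refine ⟨R0' ++ Q, by rw [h1, hR0y, List.append_assoc], by rw [h3, hρ0y], ?_⟩
      intro t ht
      rw [flat_append, List.mem_append] at ht
      rcases ht with ht | ht
      · exact Or.inr (hR0y' t ht)
      · exact Or.inl ((hT t).2 (Or.inr (h2 t ht)))
  obtain ⟨β', hβ1, hβ2⟩ : ∃ β' : V → V, (∀ v, v ∈ T ∨ (v ∈ D ∧ β v ∈ T) → β' v = b) ∧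
      (∀ v ∈ D, v ∉ T → β v ∉ T → β' v = β v) :=
    ⟨fun v => if v ∈ T ∨ (v ∈ D ∧ β v ∈ T) then b else β v, fun v h => if_pos h,
      fun v h1 h2 h3 => if_neg (by tauto)⟩
  obtain ⟨ρ', hρ1, hρ2⟩ : ∃ ρ' : V → V, (∀ v ∈ D, ρ' v = ρ v) ∧ ∀ v, v ∉ D → ρ' v = ρ b :=
    ⟨fun v => if v ∈ D then ρ v else ρ b, fun v h => if_pos h, fun v h => if_neg h⟩
  obtain ⟨L', hL1, hL2⟩ : ∃ L' : V → List (V × V),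
      (∀ v ∈ D, L' v = L v) ∧ ∀ v, v ∉ D → L' v = g v :=
    ⟨fun v => if v ∈ D then L v else g v, fun v h => if_pos h, fun v h => if_neg h⟩
  have hβb : β' b = b := by rw [hβ2 b hb hbT (by rwa [hbb]), hbb]
  have hcls : ∀ t, t ∈ T ∨ (t ∈ D ∧ β t = b) → t ∈ D ∪ T ∧ β' t = b := by
    rintro t (h | ⟨h1, h2⟩)
    · exact ⟨Or.inr h, hβ1 t (Or.inl h)⟩
    · refine ⟨Or.inl h1, ?_⟩
      by_cases h3 : t ∈ T
      · exact hβ1 t (Or.inl h3)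
      · rw [hβ2 t h1 h3 (by rwa [h2]), h2]
  have trich : ∀ v ∈ D ∪ T, (v ∉ D ∧ v ∈ T) ∨ (v ∈ D ∧ β v ∈ T) ∨ (v ∈ D ∧ v ∉ T ∧ β v ∉ T) := by
    rintro v (h | h)
    · by_cases h1 : β v ∈ T
      · exact Or.inr (Or.inl ⟨h, h1⟩)
      · exact Or.inr (Or.inr ⟨h, fun h2 => h1 (hTβ v h2 h), h1⟩)
    · by_cases h1 : v ∈ D
      · exact Or.inr (Or.inl ⟨h1, hTβ v h h1⟩)
      · exact Or.inl ⟨h1, h⟩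
  refine ⟨D ∪ T, β', ρ', L', ?_, Set.subset_union_left, ?_⟩
  · obtain ⟨v, h1, h2⟩ := hnew
    exact ⟨v, Or.inr h1, h2⟩
  constructor
  · exact fun u hu => Or.inl (S.dU u hu)
  · intro v hv
    rcases trich v hv with ⟨h1, h2⟩ | ⟨h1, h2⟩ | ⟨h1, h2, h3⟩
    · rw [hβ1 v (Or.inl h2)]; exact ⟨Or.inl hb, hβb⟩
    · rw [hβ1 v (Or.inr ⟨h1, h2⟩)]; exact ⟨Or.inl hb, hβb⟩
    · obtain ⟨h4, h5⟩ := S.dβ v h1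
      rw [hβ2 v h1 h2 h3]
      exact ⟨Or.inl h4, by rw [hβ2 _ h4 h3 (by rwa [h5]), h5]⟩
  · intro v hv hvne
    by_cases hvT : v ∈ T
    · obtain ⟨w, h1, h2⟩ := hTm v hvT
      exact ⟨w, Or.inr h1, h2, by rw [hβ1 v (Or.inl hvT), hβ1 w (Or.inl h1)]⟩
    · rcases trich v hv with ⟨h1, h2⟩ | ⟨h1, h2⟩ | ⟨h1, h2, h3⟩
      · exact absurd h2 hvT
      · obtain ⟨m, h4, h5, h6⟩ := S.closed v h1 (fun h => hvT (h ▸ h2))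
        refine ⟨m, Or.inl h4, h5, ?_⟩
        rw [hβ1 v (Or.inr ⟨h1, h2⟩), hβ1 m (Or.inr ⟨h4, by rwa [h6]⟩)]
      · rw [hβ2 v h1 h2 h3] at hvne ⊢
        obtain ⟨m, h4, h5, h6⟩ := S.closed v h1 hvne
        refine ⟨m, Or.inl h4, h5, ?_⟩
        rw [hβ2 m h4 (fun h => h2 (hTm' m h v (by rwa [Sym2.eq_swap]))) (by rwa [h6]), h6]
  · intro v hv
    by_cases hvD : v ∈ D
    · rw [hρ1 v hvD]; exact S.root v hvD
    · rw [hρ2 v hvD]; exact S.root b hb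
  · intro v hv
    by_cases hvD : v ∈ D
    · rw [hρ1 v hvD, hL1 v hvD]; exact S.ch v hvD
    · rw [hρ2 v hvD, hL2 v hvD]; exact g2 v (hv.resolve_left hvD) hvD
  · intro v hv
    by_cases hvD : v ∈ D
    · rw [hρ1 v hvD, hL1 v hvD]; exact S.nd v hvD
    · rw [hρ2 v hvD, hL2 v hvD]; exact g3 v (hv.resolve_left hvD) hvD
  · intro v hv
    by_cases hvD : v ∈ D
    · rw [hρ1 v hvD, hL1 v hvD]; exact S.en v hvD
    · rw [hρ2 v hvD, hL2 v hvD]; exact g4 v (hv.resolve_left hvD) hvD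
  · intro v hv
    rcases trich v hv with ⟨h1, h2⟩ | ⟨h1, h2⟩ | ⟨h1, h2, h3⟩
    · rw [hβ1 v (Or.inl h2), hL1 b hb, hρ1 b hb, hL2 v h1, hρ2 v h1]
      exact ⟨R v, g1 v h2 h1, rfl, fun t ht => hcls t (g5 v h2 h1 t ht)⟩
    · rw [hβ1 v (Or.inr ⟨h1, h2⟩), hL1 b hb, hρ1 b hb, hL1 v h1, hρ1 v h1]
      obtain ⟨R1, h3, h4, h5⟩ := S.pre v h1
      obtain ⟨hc, hcc⟩ := S.dβ v h1
      obtain ⟨Q, h6, h7, h8⟩ := hclimb _ hc hcc h2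
      refine ⟨Q ++ R1, by rw [h3, h6, List.append_assoc], by rw [h4, h7], ?_⟩
      intro t ht
      rw [flat_append, List.mem_append] at ht
      rcases ht with ht | ht
      · exact hcls t (h8 t ht)
      · obtain ⟨h9, h10⟩ := h5 t ht
        exact ⟨Or.inl h9, hβ1 t (Or.inr ⟨h9, by rwa [h10]⟩)⟩
    · obtain ⟨R1, h4, h5, h6⟩ := S.pre v h1
      have hc := (S.dβ v h1).1
      rw [hβ2 v h1 h2 h3, hL1 v h1, hρ1 v h1, hL1 _ hc, hρ1 _ hc]
      refine ⟨R1, h4, h5, fun t ht => ?_⟩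
      obtain ⟨h7, h8⟩ := h6 t ht
      refine ⟨Or.inl h7, ?_⟩
      rw [hβ2 t h7 (fun h => h3 (h8 ▸ hTβ t h h7)) (by rwa [h8]), h8]
  · have key : ∀ v ∈ D, v ∉ T → β v = v → L' v = [] ∨
        ∃ z ∈ D ∪ T, ∃ a, a ∉ D ∪ T ∧ L' v = L' z ++ [(a, v)] ∧ ρ' v = ρ' z := by
      intro v h1 h2 h3
      rw [hL1 v h1, hρ1 v h1]
      rcases S.base v h1 h3 with h | ⟨z, hz, a, ha, h4, h5⟩
      · exact Or.inl h
      · refine Or.inr ⟨z, Or.inl hz, a, ?_, by rwa [hL1 z hz], by rwa [hρ1 z hz]⟩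
        rintro (h | h)
        · exact ha h
        · have h6 := S.ch v h1
          rw [h4] at h6
          simp at h6
          exact h2 (hTm' a h v h6.2.2)
    intro v hv h
    rcases trich v hv with ⟨h1, h2⟩ | ⟨h1, h2⟩ | ⟨h1, h2, h3⟩
    · rw [hβ1 v (Or.inl h2)] at h
      exact absurd (h ▸ hb) h1
    · rw [hβ1 v (Or.inr ⟨h1, h2⟩)] at h
      subst h
      exact key b hb hbT hbb
    · rw [hβ2 v h1 h2 h3] at h
      exact key v h1 h2 h

lemma St.trace (S : St F K D β ρ L) (hF : IsMatching F) {p : List V} (hp : Augmenting F p) :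
    ∃ x y, s(x, y) ∈ pathAllEdges p ∧ s(x, y) ∉ F ∧ x ∈ D ∧
      ((y ∉ D ∧ ∃ w, w ∉ D ∧ s(y, w) ∈ F) ∨ (y ∈ D ∧ β x ≠ β y)) := by
  obtain ⟨hp0, ⟨-, hnd, halt⟩, heven, hhead, hlast⟩ := hp
  by_contra hcon
  have J : ∀ i, ∃ h : 2 * i < p.length, p[2 * i] ∈ D ∧
      ∃ j, ∃ hj : j ≤ i, β (p[2 * i]) = p[2 * j] := by
    intro i
    induction i with
    | zero =>
      have h0 : 0 < p.length := List.length_pos_iff.2 hp0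
      have hu : ¬ covered F p[0] := by rwa [List.head_eq_getElem] at hhead
      refine ⟨h0, S.dU _ hu, 0, le_rfl, ?_⟩
      by_contra hne
      obtain ⟨m, -, hm, -⟩ := S.closed _ (S.dU _ hu) (fun h => hne h.symm)
      exact hu ⟨_, hm, by simp⟩
    | succ i ih =>
      obtain ⟨h, hD, j, hj, hβ⟩ := ih
      have h1 : 2 * i + 1 < p.length := by
        obtain ⟨k, hk⟩ := heven
        omega
      have hnF := (halt (2 * i) h1).1 (by omega)
      have hcov : covered F p[2 * i + 1] → ∃ h2 : 2 * i + 1 + 1 < p.length,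
          s(p[2 * i + 1], p[2 * i + 1 + 1]) ∈ F := by
        intro hc
        by_cases h2 : 2 * i + 1 + 1 < p.length
        · exact ⟨h2, (halt (2 * i + 1) h2).2 (by omega)⟩
        · exfalso
          rw [List.getLast_eq_getElem] at hlast
          have : p.length - 1 = 2 * i + 1 := by omega
          simp only [this] at hlast
          exact hlast hc
      have hedge : s(p[2 * i], p[2 * i + 1]) ∈ pathAllEdges p := ⟨2 * i, h1, rfl⟩
      by_cases hy : p[2 * i + 1] ∈ D
      · have hββ : β p[2 * i] = β p[2 * i + 1] := by
          by_contra hne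
          exact hcon ⟨_, _, hedge, hnF, hD, Or.inr ⟨hy, hne⟩⟩
        have hne : p[2 * i + 1] ≠ β p[2 * i + 1] := by
          rw [← hββ, hβ]
          intro h3
          have := (hnd.getElem_inj_iff).1 h3
          omega
        obtain ⟨m, hm, hmF, hmβ⟩ := S.closed _ hy hne
        obtain ⟨h2, hF2⟩ := hcov ⟨_, hmF, by simp⟩
        have := mate_unique hF hmF hF2
        subst this
        exact ⟨h2, hm, j, by omega, hmβ.trans (hββ.symm.trans hβ)⟩
      · have hc : covered F p[2 * i + 1] := by
          by_contra hc
          exact hy (S.dU _ hc)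
        obtain ⟨h2, hF2⟩ := hcov hc
        have hw : p[2 * i + 1 + 1] ∈ D := by
          by_contra hw
          exact hcon ⟨_, _, hedge, hnF, hD, Or.inl ⟨hy, _, hw, hF2⟩⟩
        refine ⟨h2, hw, i + 1, le_rfl, ?_⟩
        by_contra hne
        obtain ⟨m, hm, hmF, -⟩ := S.closed _ hw (fun h => hne h.symm)
        rw [Sym2.eq_swap] at hF2
        exact hy (mate_unique hF hF2 hmF ▸ hm)
  obtain ⟨h, -⟩ := J p.length
  omega

lemma St.start : St F K {u | ¬ covered F u} id id (fun _ => []) := by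
  constructor <;> simp

lemma St.covD (S : St F K D β ρ L) : D = {v ∈ D | covered F v} ∪ {u | ¬ covered F u} := by
  ext v
  have := S.dU v
  simp only [Set.mem_union, Set.mem_ofPred_eq]
  tauto

lemma cov_finite (hfin : F.Finite) :
    {v | covered F v}.Finite ∧ {v | covered F v}.ncard ≤ 2 * F.ncard := by
  classical
  have h : {v | covered F v} = ((hfin.toFinset.biUnion fun e => e.toFinset : Finset V) : Set V) := by
    ext v
    simp [covered]
  rw [h]
  refine ⟨Finset.finite_toSet _, ?_⟩
  rw [Set.ncard_coe_finset, Set.ncard_eq_toFinset_card F hfin, mul_comm]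
  refine Finset.card_biUnion_le_card_mul _ _ _ fun e _ => ?_
  rw [Sym2.card_toFinset]
  split <;> omega

lemma main_ind (hF : IsMatching F) (hfin : F.Finite) {m : ℕ} (P : Fin m → List V)
    (hP : ∀ i, Augmenting F (P i)) (v0 : V) : ∀ t, t ≤ m →
    (∃ q, Augmenting F q ∧ ∃ c : ℕ → Sym2 V, ∃ n ≤ m,
      (∀ i : Fin m, i.1 < n → c i ∈ pathAllEdges (P i)) ∧
      ∀ e ∈ pathKEdges q, ∃ i < n, c i = e) ∨
    ∃ c : ℕ → Sym2 V, (∀ i : Fin m, i.1 < t → c i ∈ pathAllEdges (P i)) ∧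
      (∀ i < t, c i ∉ F) ∧
      ∃ D β ρ L, St F {e | ∃ i < t, c i = e} D β ρ L ∧ t ≤ {v ∈ D | covered F v}.ncard := by
  intro t
  induction t with
  | zero =>
    intro _
    right
    exact ⟨fun _ => s(v0, v0), by simp, by simp, _, _, _, _, St.start, by simp⟩
  | succ t ih =>
    intro htm
    rcases ih (by omega) with h | ⟨c, hc1, hc2, D, β, ρ, L, S, hcard⟩
    · exact Or.inl h
    obtain ⟨x, y, hxyP, hxyF, hx, hxy⟩ := S.trace hF (hP ⟨t, htm⟩)
    obtain ⟨c', hc', hct⟩ : ∃ c' : ℕ → Sym2 V, (∀ i < t, c' i = c i) ∧ c' t = s(x, y) :=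
      ⟨fun i => if i = t then s(x, y) else c i, fun i hi => if_neg (by omega), if_pos rfl⟩
    have k1 : ∀ i : Fin m, i.1 < t + 1 → c' i ∈ pathAllEdges (P i) := by
      intro i hi
      rcases Nat.lt_succ_iff_lt_or_eq.1 hi with h | h
      · rw [hc' _ h]; exact hc1 i h
      · have : i = ⟨t, htm⟩ := Fin.ext h
        subst this
        rw [hct]; exact hxyP
    have k2 : ∀ i < t + 1, c' i ∉ F := by
      intro i hi
      rcases Nat.lt_succ_iff_lt_or_eq.1 hi with h | h
      · rw [hc' _ h]; exact hc2 i h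
      · rw [h, hct]; exact hxyF
    have S' : St F {e | ∃ i < t + 1, c' i = e} D β ρ L := by
      refine S.mono ?_
      rintro e ⟨i, hi, rfl⟩
      exact ⟨i, by omega, hc' i hi⟩
    have hin : s(x, y) ∈ {e | ∃ i < t + 1, c' i = e} := ⟨t, by omega, hct⟩
    have grow : ∀ D' β' ρ' L', (∃ v ∈ D', v ∉ D) → D ⊆ D' →
        St F {e | ∃ i < t + 1, c' i = e} D' β' ρ' L' →
        t + 1 ≤ {v ∈ D' | covered F v}.ncard := by
      rintro D' β' ρ' L' ⟨v, h1, h2⟩ h3 -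
      refine lt_of_le_of_lt hcard (Set.ncard_lt_ncard ?_ ((cov_finite hfin).1.subset ?_))
      · have hsub : {v ∈ D | covered F v} ⊆ {v ∈ D' | covered F v} :=
          fun v hv => ⟨h3 hv.1, hv.2⟩
        refine (Set.ssubset_iff_of_subset hsub).2 ?_
        refine ⟨v, ⟨h1, ?_⟩, fun h => h2 h.1⟩
        by_contra hc
        exact h2 (S.dU v hc)
      · exact fun v hv => hv.2
    rcases hxy with ⟨hy, w, hw, hyw⟩ | ⟨hy, hne⟩
    · obtain ⟨β', ρ', L', S2⟩ := S'.step1 hF hx hy hw hin hyw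
      exact Or.inr ⟨c', k1, k2, _, β', ρ', L', S2,
        grow _ _ _ _ ⟨w, Set.mem_insert _ _, hw⟩ (Set.subset_insert _ _) S2⟩
    · rcases S'.step2 hF (by rintro e ⟨i, hi, rfl⟩; exact k2 i hi) hx hy hne hin with
        ⟨q, hq, hqK⟩ | ⟨D', β', ρ', L', h1, h2, S2⟩
      · exact Or.inl ⟨q, hq, c', t + 1, htm, k1, fun e he => hqK he⟩
      · exact Or.inr ⟨c', k1, k2, D', β', ρ', L', S2, grow _ _ _ _ h1 h2 S2⟩

end MC


/-- if `P` is a family of more than `2|F|` `F`-augmenting `F`-alternating paths,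
then there is an `F`-augmenting `F`-alternating path whose non-`F` edges come from pairwise
distinct members of the family (a multicolored augmenting path). -/
theorem stmt_16 {V : Type*} (F : Set (Sym2 V)) (hF : IsMatching F) (hfin : F.Finite)
    (m : ℕ) (hm : 2 * F.ncard < m) (P : Fin m → List V) (hP : ∀ i, Augmenting F (P i)) :
    ∃ q : List V, Augmenting F q ∧ ∃ φ : Sym2 V → Fin m,
      Set.InjOn φ (pathKEdges q) ∧ ∀ e ∈ pathKEdges q, e ∈ pathAllEdges (P (φ e)) := by
  classical
  have hm0 : 0 < m := by omega
  obtain ⟨hp0, -⟩ := hP ⟨0, hm0⟩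
  rcases MC.main_ind hF hfin P hP ((P ⟨0, hm0⟩).head hp0) m le_rfl with
    ⟨q, hq, c, n, hn, h1, h2⟩ | ⟨c, -, -, D, β, ρ, L, S, hcard⟩
  · refine ⟨q, hq, ?_⟩
    have h3 : ∀ e, ∃ i : Fin m, e ∈ pathKEdges q → i.1 < n ∧ c i = e := by
      intro e
      by_cases he : e ∈ pathKEdges q
      · obtain ⟨i, hi, hc⟩ := h2 e he
        exact ⟨⟨i, by omega⟩, fun _ => ⟨hi, hc⟩⟩
      · exact ⟨⟨0, hm0⟩, fun h => absurd h he⟩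
    choose φ hφ using h3
    refine ⟨φ, ?_, ?_⟩
    · intro e he e' he' hee
      rw [← (hφ e he).2, ← (hφ e' he').2, hee]
    · intro e he
      have := h1 (φ e) (hφ e he).1
      rwa [(hφ e he).2] at this
  · exfalso
    obtain ⟨hc1, hc2⟩ := MC.cov_finite hfin
    have : {v ∈ D | covered F v}.ncard ≤ {v | covered F v}.ncard :=
      Set.ncard_le_ncard (fun v hv => hv.2) hc1
    omega
end

section
/- There exist a matching F of size k and a family of 2k F-augmenting F-alternating paths that admit no F-augmenting multicolored alternating path. Concretely, with F = {u_i v_i : 1 ≤ i ≤ k−1} ∪ {xy}, take k copies of the path with non-F edges {x u_1, v_{k-1} y} ∪ {v_i u_{i+1} : i ≤ k−2} and k copies of the path with non-F edges {x v_1, u_{k-1} y} ∪ {u_i v_{i+1} : i ≤ k−2}; then no augmenting F-alternating path has all its non-F edges coming from distinct members of the family. -/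
variable {V : Type*}

/-- The layer swap: exchanges `2i+1` and `2i+2` for `i < k`. -/
def sw (k : ℕ) (a : ℕ) : ℕ :=
  if a = 0 then 0 else if 2 * k + 1 ≤ a then a else if a % 2 = 1 then a + 1 else a - 1

def fb (k : ℕ) (b : Bool) (a : ℕ) : ℕ := if b = true then sw k a else a

def Fe (k a b : ℕ) : Prop :=
  (a % 2 = 1 ∧ b = a + 1 ∧ b ≤ 2 * k) ∨ (b % 2 = 1 ∧ a = b + 1 ∧ a ≤ 2 * k)

def AK (k a b : ℕ) : Prop :=
  (a % 2 = 0 ∧ b = a + 1 ∧ b ≤ 2 * k + 1) ∨ (b % 2 = 0 ∧ a = b + 1 ∧ a ≤ 2 * k + 1)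

/-- Edges of the second path. -/
def BK (k a b : ℕ) : Prop :=
  (a = 0 ∧ b = 2) ∨ (a % 2 = 1 ∧ b = a + 3 ∧ b ≤ 2 * k) ∨ (a + 1 = 2 * k ∧ b = 2 * k + 1)

def TK (k : ℕ) (t : Bool) (a b : ℕ) : Prop :=
  if t = true then BK k a b ∨ BK k b a else AK k a b

lemma sw_cases (k a : ℕ) : (a = 0 ∧ sw k a = 0) ∨ (1 ≤ a ∧ 2 * k + 1 ≤ a ∧ sw k a = a) ∨
    (1 ≤ a ∧ a ≤ 2 * k ∧ a % 2 = 1 ∧ sw k a = a + 1) ∨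
    (1 ≤ a ∧ a ≤ 2 * k ∧ a % 2 = 0 ∧ sw k a + 1 = a) := by
  unfold sw
  split_ifs <;> omega

def FF (k : ℕ) : Set (Sym2 ℕ) := (fun i => s(2 * i + 1, 2 * i + 2)) '' (Set.Iio k)

lemma mem_FF (k a b : ℕ) : s(a, b) ∈ FF k ↔ Fe k a b := by
  simp only [FF, Fe, Set.mem_image, Set.mem_Iio, Sym2.eq_iff]
  constructor
  · rintro ⟨i, hi, h⟩; omega
  · rintro (h | h)
    · exact ⟨a / 2, by omega, by omega⟩
    · exact ⟨b / 2, by omega, by omega⟩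

lemma cov_FF (k v : ℕ) : covered (FF k) v ↔ 1 ≤ v ∧ v ≤ 2 * k := by
  constructor
  · rintro ⟨e, ⟨i, hi, rfl⟩, h⟩
    simp only [Sym2.mem_iff, Set.mem_Iio] at h hi
    omega
  · intro h
    refine ⟨_, ⟨(v - 1) / 2, ?_, rfl⟩, ?_⟩
    · simp only [Set.mem_Iio]; omega
    · simp only [Sym2.mem_iff]; omega

lemma FF_matching (k : ℕ) : IsMatching (FF k) := by
  constructor
  · rintro e ⟨i, hi, rfl⟩
    simp
  · rintro e ⟨i, hi, rfl⟩ f ⟨j, hj, rfl⟩ hne v hv hv'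
    simp only [Sym2.mem_iff] at hv hv'
    apply hne
    have : i = j := by omega
    rw [this]

lemma FF_ncard (k : ℕ) : (FF k).ncard = k := by
  rw [FF, Set.ncard_image_of_injective]
  · rw [Set.ncard_eq_toFinset_card', Set.toFinset_Iio, Nat.card_Iio]
  · intro i j h
    simp only [Sym2.eq_iff] at h
    omega

def PP (k : ℕ) (t : Bool) : List ℕ := (List.range (2 * k + 2)).map (fb k t)

lemma PP_edges (k : ℕ) (hk : 1 ≤ k) (t : Bool) (a b : ℕ) (h : s(a, b) ∈ pathAllEdges (PP k t)) :
    Fe k a b ∨ TK k t a b := by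
  obtain ⟨i, hi, h⟩ := h
  simp only [PP, List.length_map, List.length_range] at hi
  simp only [PP, List.getElem_map, List.getElem_range, Sym2.eq_iff] at h
  cases t <;> simp only [fb, TK, if_true, Bool.false_eq_true, if_false] at h ⊢
  · unfold Fe AK
    omega
  · have key : Fe k (sw k i) (sw k (i + 1)) ∨ BK k (sw k i) (sw k (i + 1)) := by
      unfold Fe BK
      rcases sw_cases k i with h1 | h1 | h1 | h1 <;>
      rcases sw_cases k (i + 1) with h2 | h2 | h2 | h2 <;> omega
    rcases h with ⟨ha, hb⟩ | ⟨ha, hb⟩ <;> rw [← ha, ← hb] at key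
    · exact key.imp id Or.inl
    · exact key.imp (fun h => Or.symm h) Or.inr

lemma PP_aug (k : ℕ) (hk : 1 ≤ k) (t : Bool) : Augmenting (FF k) (PP k t) := by
  have hne : PP k t ≠ [] := by simp [PP]
  refine ⟨hne, ⟨hne, ?_, ?_⟩, ?_, ?_, ?_⟩
  · refine List.Nodup.map_on ?_ List.nodup_range
    intro x hx y hy h
    cases t <;> simp only [fb, if_true, Bool.false_eq_true, if_false] at h
    · exact h
    · rcases sw_cases k x with h1 | h1 | h1 | h1 <;>
      rcases sw_cases k y with h2 | h2 | h2 | h2 <;> omega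
  · intro i hi
    simp only [PP, List.length_map, List.length_range] at hi
    simp only [PP, List.getElem_map, List.getElem_range, mem_FF]
    cases t <;> simp only [fb, Fe, if_true, true_and, Bool.false_eq_true, if_false]
    · constructor <;> intro h <;> omega
    · constructor <;> intro h <;>
      rcases sw_cases k i with h1 | h1 | h1 | h1 <;>
      rcases sw_cases k (i + 1) with h2 | h2 | h2 | h2 <;> omega
  · simp [PP, parity_simps]
  · rw [cov_FF, List.head_eq_getElem]
    simp only [PP, List.getElem_map, List.getElem_range]
    cases t <;> simp [fb, sw]
  · rw [cov_FF, List.getLast_eq_getElem]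
    simp only [PP, List.getElem_map, List.getElem_range, List.length_map, List.length_range]
    cases t <;> simp only [fb, if_true, Bool.false_eq_true, if_false]
    · omega
    · rcases sw_cases k (2 * k + 2 - 1) with h1 | h1 | h1 | h1 <;> omega

def gg (k : ℕ) (t r : Bool) (i : ℕ) : ℕ := fb k t (if r = true then 2 * k + 1 - i else i)

lemma core_start (k : ℕ) (hk : 1 ≤ k) (a b : ℕ) (ha : ¬ (1 ≤ a ∧ a ≤ 2 * k)) (t : Bool)
    (h : TK k t a b) : ∃ r, a = gg k t r 0 ∧ b = gg k t r 1 := by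
  by_cases h0 : a = 0
  · refine ⟨false, ?_⟩
    cases t <;> simp only [gg, fb, Fe, TK, AK, BK, if_true, Bool.false_eq_true, if_false] at h ⊢
    · omega
    · rcases sw_cases k (0) with h7 | h7 | h7 | h7 <;>
      rcases sw_cases k (1) with h8 | h8 | h8 | h8 <;> omega
  · refine ⟨true, ?_⟩
    cases t <;> simp only [gg, fb, Fe, TK, AK, BK, if_true, Bool.false_eq_true, if_false] at h ⊢
    · omega
    · rcases sw_cases k (2 * k + 1 - 0) with h7 | h7 | h7 | h7 <;>
      rcases sw_cases k (2 * k + 1 - 1) with h8 | h8 | h8 | h8 <;> omega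

lemma core_F (k : ℕ) (t r : Bool) (i b : ℕ) (hi : i % 2 = 1) (hi' : i ≤ 2 * k + 1)
    (h : Fe k (gg k t r i) b) : i + 2 ≤ 2 * k + 1 ∧ b = gg k t r (i + 1) := by
  cases t <;> cases r <;>
    simp only [gg, fb, Fe, TK, AK, BK, if_true, Bool.false_eq_true, if_false] at h ⊢
  · omega
  · omega
  · rcases sw_cases k (i) with h7 | h7 | h7 | h7 <;>
      rcases sw_cases k (i + 1) with h8 | h8 | h8 | h8 <;> omega
  · rcases sw_cases k (2 * k + 1 - i) with h7 | h7 | h7 | h7 <;>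
      rcases sw_cases k (2 * k + 1 - (i + 1)) with h8 | h8 | h8 | h8 <;> omega

lemma core_E (k : ℕ) (hk : 1 ≤ k) (t r t' : Bool) (i b : ℕ) (hi : i % 2 = 0) (h2 : 2 ≤ i)
    (hi' : i ≤ 2 * k) (h : TK k t' (gg k t r i) b) :
    b = gg k t r (i + 1) ∨ b = gg k t r (i - 3) := by
  cases t <;> cases r
  · cases t' <;>
    simp only [gg, fb, Fe, TK, AK, BK, if_true, Bool.false_eq_true, if_false] at h ⊢ <;> omega
  · cases t' <;>
    simp only [gg, fb, Fe, TK, AK, BK, if_true, Bool.false_eq_true, if_false] at h ⊢ <;> omega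
  · cases t' <;>
    simp only [gg, fb, Fe, TK, AK, BK, if_true, Bool.false_eq_true, if_false] at h ⊢ <;>
      rcases sw_cases k (i) with h7 | h7 | h7 | h7 <;>
      rcases sw_cases k (i + 1) with h8 | h8 | h8 | h8 <;>
      rcases sw_cases k (i - 3) with h9 | h9 | h9 | h9 <;> omega
  · cases t' <;>
    simp only [gg, fb, Fe, TK, AK, BK, if_true, Bool.false_eq_true, if_false] at h ⊢ <;>
      rcases sw_cases k (2 * k + 1 - i) with h7 | h7 | h7 | h7 <;>
      rcases sw_cases k (2 * k + 1 - (i + 1)) with h8 | h8 | h8 | h8 <;>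
      rcases sw_cases k (2 * k + 1 - (i - 3)) with h9 | h9 | h9 | h9 <;> omega

lemma core_T (k : ℕ) (hk : 1 ≤ k) (t r t' : Bool) (i : ℕ) (hi : i % 2 = 0)
    (hi' : i ≤ 2 * k) (h : TK k t' (gg k t r i) (gg k t r (i + 1))) : t' = t := by
  cases t <;> cases t' <;> first | rfl | skip
  all_goals
    exfalso
    cases r <;> simp only [gg, fb, TK, AK, BK, if_true, Bool.false_eq_true, if_false] at h
  · omega
  · omega
  · rcases sw_cases k (i) with h7 | h7 | h7 | h7 <;>
      rcases sw_cases k (i + 1) with h8 | h8 | h8 | h8 <;> omega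
  · rcases sw_cases k (2 * k + 1 - i) with h7 | h7 | h7 | h7 <;>
      rcases sw_cases k (2 * k + 1 - (i + 1)) with h8 | h8 | h8 | h8 <;> omega

lemma core_end (k : ℕ) (t r : Bool) (i : ℕ) (hi : i % 2 = 1)
    (hi' : i ≤ 2 * k + 1) (h : ¬ (1 ≤ gg k t r i ∧ gg k t r i ≤ 2 * k)) : i = 2 * k + 1 := by
  cases t <;> cases r <;>
    simp only [gg, fb, if_true, Bool.false_eq_true, if_false] at h
  · omega
  · omega
  · rcases sw_cases k (i) with h7 | h7 | h7 | h7 <;> omega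
  · rcases sw_cases k (2 * k + 1 - i) with h7 | h7 | h7 | h7 <;> omega

lemma core (k n : ℕ) (hk : 1 ≤ k) (g : ℕ → ℕ) (hn : n % 2 = 0) (hn0 : 0 < n)
    (inj : ∀ i < n, ∀ j < n, g i = g j → i = j)
    (hF : ∀ i, i + 1 < n → i % 2 = 1 → Fe k (g i) (g (i + 1)))
    (hE : ∀ i, i + 1 < n → i % 2 = 0 → ∃ t, TK k t (g i) (g (i + 1)))
    (h0 : ¬ (1 ≤ g 0 ∧ g 0 ≤ 2 * k)) (hl : ¬ (1 ≤ g (n - 1) ∧ g (n - 1) ≤ 2 * k)) :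
    n = 2 * k + 2 ∧ ∃ t, ∀ i, i + 1 < n → i % 2 = 0 → ∀ t', TK k t' (g i) (g (i + 1)) → t' = t := by
  obtain ⟨t, ht⟩ := hE 0 (by omega) rfl
  obtain ⟨r, hr0, hr1⟩ := core_start k hk _ _ h0 t ht
  have key : ∀ j, 2 * j + 1 < n → 2 * j + 1 ≤ 2 * k + 1 ∧ ∀ i ≤ 2 * j + 1, g i = gg k t r i := by
    intro j
    induction j with
    | zero =>
      intro _
      refine ⟨by omega, fun i hi => ?_⟩
      interval_cases i
      · exact hr0
      · exact hr1
    | succ j ih =>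
      intro hj
      obtain ⟨hle, ih⟩ := ih (by omega)
      have h1 := hF (2 * j + 1) (by omega) (by omega)
      rw [ih _ le_rfl] at h1
      obtain ⟨hle', h2⟩ := core_F k t r _ _ (by omega) hle h1
      obtain ⟨t', h3⟩ := hE (2 * j + 2) (by omega) (by omega)
      rw [show 2 * j + 1 + 1 = 2 * j + 2 from rfl] at h2
      rw [h2] at h3
      have h4 := core_E k hk t r t' _ _ (by omega) (by omega) (by omega) h3
      have h5 : g (2 * j + 3) = gg k t r (2 * j + 3) := by
        rcases h4 with h4 | h4
        · exact h4
        · rw [← ih _ (by omega)] at h4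
          have := inj _ (by omega) _ (by omega) h4
          omega
      refine ⟨by omega, fun i hi => ?_⟩
      rcases Nat.lt_or_ge i (2 * j + 2) with h | h
      · exact ih i (by omega)
      · obtain rfl | rfl : i = 2 * j + 2 ∨ i = 2 * j + 3 := by omega
        · exact h2
        · exact h5
  obtain ⟨hle, hg⟩ := key (n / 2 - 1) (by omega)
  have e : 2 * (n / 2 - 1) + 1 = n - 1 := by omega
  rw [e] at hle hg
  rw [hg _ le_rfl] at hl
  have := core_end k t r _ (by omega) hle hl
  refine ⟨by omega, t, fun i hi hi2 t' h => ?_⟩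
  rw [hg _ (by omega), hg _ (by omega)] at h
  exact core_T k hk t r t' i hi2 (by omega) h

/-- for every `k ≥ 2` there is a matching `F` of size `k` and a family of `2k`
`F`-augmenting `F`-alternating paths admitting no multicolored augmenting path (so the bound
`2|F|` in Statement 16 is sharp).  A witness is `F = {u_iv_i : i ≤ k−1} ∪ {xy}` with `k` copies
of the path with non-`F` edges `{xu_1, v_{k−1}y} ∪ {v_iu_{i+1}}` and `k` copies of the path
with non-`F` edges `{xv_1, u_{k−1}y} ∪ {u_iv_{i+1}}`. -/
theorem stmt_17 (k : ℕ) (hk : 2 ≤ k) :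
    ∃ F : Set (Sym2 ℕ), IsMatching F ∧ F.Finite ∧ F.ncard = k ∧
      ∃ P : Fin (2 * k) → List ℕ, (∀ i, Augmenting F (P i)) ∧
        ¬ ∃ q : List ℕ, Augmenting F q ∧ ∃ φ : Sym2 ℕ → Fin (2 * k),
          Set.InjOn φ (pathKEdges q) ∧ ∀ e ∈ pathKEdges q, e ∈ pathAllEdges (P (φ e)) := by
  refine ⟨FF k, FF_matching k, (Set.finite_Iio k).image _, FF_ncard k,
    fun i => PP k (decide (i.val < k)), fun i => PP_aug k (by omega) _, ?_⟩
  rintro ⟨q, ⟨hne, ⟨-, hnd, halt⟩, hev, hh, hl⟩, φ, hinj, hφ⟩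
  have hget : ∀ i (h : i < q.length), q.getD i 0 = q[i] := fun i h => by
    simp [List.getD_eq_getElem?_getD, h]
  have hpos : 0 < q.length := List.length_pos_iff.mpr hne
  have hmem : ∀ i, i + 1 < q.length → i % 2 = 0 →
      s(q.getD i 0, q.getD (i + 1) 0) ∈ pathKEdges q := by
    intro i hi h2
    refine ⟨i, hi, h2, ?_⟩
    rw [hget _ (by omega), hget _ hi]
  have hT : ∀ i, i + 1 < q.length → i % 2 = 0 →
      TK k (decide ((φ s(q.getD i 0, q.getD (i + 1) 0)).val < k)) (q.getD i 0)
        (q.getD (i + 1) 0) := by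
    intro i hi h2
    have h3 := PP_edges _ (by omega) _ _ _ (hφ _ (hmem i hi h2))
    refine h3.resolve_left fun h => ?_
    refine (halt i hi).1 h2 ?_
    rw [mem_FF, ← hget _ (by omega), ← hget _ hi]
    exact h
  obtain ⟨hlen, t, ht⟩ := core k q.length (by omega) (fun i => q.getD i 0)
    (Nat.even_iff.mp hev) hpos
    (by
      intro i hi j hj h
      simp only [hget i hi, hget j hj] at h
      exact (List.Nodup.getElem_inj_iff hnd).mp h)
    (by
      intro i hi h2
      have := (halt i hi).2 h2
      rw [mem_FF, ← hget _ (by omega), ← hget _ hi] at this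
      exact this)
    (fun i hi h2 => ⟨_, hT i hi h2⟩)
    (by
      rw [cov_FF, List.head_eq_getElem, ← hget _ hpos] at hh
      exact hh)
    (by
      rw [cov_FF, List.getLast_eq_getElem, ← hget _ (by omega)] at hl
      exact hl)
  have hcol : ∀ i, i + 1 < q.length → i % 2 = 0 →
      decide ((φ s(q.getD i 0, q.getD (i + 1) 0)).val < k) = t :=
    fun i hi h2 => ht i hi h2 _ (hT i hi h2)
  -- pigeonhole: `k + 1` edges, `k` colours
  let ψ : ℕ → ℕ := fun j => (φ s(q.getD (2 * j) 0, q.getD (2 * j + 1) 0)).val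
  have hψ : Set.InjOn ψ (Finset.range (k + 1)) := by
    intro i hi j hj h
    simp only [Finset.coe_range, Set.mem_Iio] at hi hj
    have h1 := hinj (hmem (2 * i) (by omega) (by omega)) (hmem (2 * j) (by omega) (by omega))
      (Fin.ext h)
    rw [hget _ (by omega), hget _ (by omega), hget _ (by omega), hget _ (by omega),
      Sym2.eq_iff, hnd.getElem_inj_iff, hnd.getElem_inj_iff, hnd.getElem_inj_iff,
      hnd.getElem_inj_iff] at h1
    omega
  have hmaps : Set.MapsTo ψ (Finset.range (k + 1))
      (if t = true then Finset.range k else Finset.Ico k (2 * k) : Finset ℕ) := by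
    intro i hi
    simp only [Finset.coe_range, Set.mem_Iio] at hi
    have h1 := hcol (2 * i) (by omega) (by omega)
    have h2 := (φ s(q.getD (2 * i) 0, q.getD (2 * i + 1) 0)).isLt
    cases t
    · simp only [decide_eq_false_iff_not, not_lt] at h1
      simp only [Bool.false_eq_true, if_false, Finset.coe_Ico, Set.mem_Ico]
      exact ⟨h1, h2⟩
    · simp only [decide_eq_true_eq] at h1
      simp only [if_true, Finset.coe_range, Set.mem_Iio]
      exact h1
  have hc := Finset.card_le_card_of_injOn ψ hmaps hψ
  cases t
  · simp at hc; omega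
  · simp at hc
end

section
/- Any family of 3n−2 matchings, each of size n, in an arbitrary (not necessarily bipartite) graph has a rainbow matching of size n. -/
variable {V : Type*}

/-- A rainbow matching of size `n` for a family `M` of edge sets: `n` edges, one from each of
`n` distinct members of the family, forming a matching. -/
def HasRainbow {V : Type*} [DecidableEq V] {m : ℕ} (n : ℕ) (M : Fin m → Finset (Sym2 V)) :
    Prop :=
  ∃ (f : Fin n → Fin m) (e : Fin n → Sym2 V),
    Function.Injective f ∧ (∀ j, e j ∈ M (f j)) ∧ Function.Injective e ∧
    IsMatching ((Finset.image e Finset.univ : Finset (Sym2 V)) : Set (Sym2 V))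

/-- `Mt N`: the finite edge set `N` is a matching. -/
def Mt (N : Finset (Sym2 V)) : Prop := IsMatching (N : Set (Sym2 V))

/-- covered by a finite edge set -/
def Cv (N : Finset (Sym2 V)) (v : V) : Prop := ∃ e ∈ N, v ∈ e

theorem Mt.subset {N N' : Finset (Sym2 V)} (h : Mt N) (hs : N' ⊆ N) : Mt N' :=
  ⟨fun e he => h.1 e (hs he), fun e he f hf => h.2 e (hs he) f (hs hf)⟩

theorem Mt.uniq {N : Finset (Sym2 V)} (h : Mt N) {e f : Sym2 V} (he : e ∈ N) (hf : f ∈ N)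
    {v : V} (hv : v ∈ e) (hv' : v ∈ f) : e = f := by
  by_contra hne
  exact h.2 e he f hf hne v hv hv'

theorem Mt.ne {N : Finset (Sym2 V)} (h : Mt N) {x y : V} (he : s(x, y) ∈ N) : x ≠ y := by
  have := h.1 _ he
  simpa using this

theorem Cv.mono {N N' : Finset (Sym2 V)} (hs : N' ⊆ N) {v : V} (h : Cv N' v) : Cv N v := by
  obtain ⟨e, he, hv⟩ := h
  exact ⟨e, hs he, hv⟩

theorem Cv.edge {N : Finset (Sym2 V)} {v : V} (h : Cv N v) : ∃ u, s(v, u) ∈ N := by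
  obtain ⟨e, he, u, rfl⟩ := h
  exact ⟨u, he⟩

section
variable [DecidableEq V]

theorem Cv_insert {N : Finset (Sym2 V)} {x y v : V} :
    Cv (insert s(x, y) N) v ↔ v = x ∨ v = y ∨ Cv N v := by
  simp [Cv, or_assoc]

theorem Mt.cv_erase {N : Finset (Sym2 V)} (h : Mt N) {x y : V} (he : s(x, y) ∈ N) (v : V) :
    Cv (N.erase s(x, y)) v ↔ v ≠ x ∧ v ≠ y ∧ Cv N v := by
  constructor
  · rintro ⟨f, hf, hv⟩
    rw [Finset.mem_erase] at hf
    refine ⟨?_, ?_, f, hf.2, hv⟩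
    · rintro rfl
      exact hf.1 (h.uniq hf.2 he hv (by simp))
    · rintro rfl
      exact hf.1 (h.uniq hf.2 he hv (by simp))
  · rintro ⟨h1, h2, f, hf, hv⟩
    refine ⟨f, ?_, hv⟩
    rw [Finset.mem_erase]
    refine ⟨?_, hf⟩
    rintro rfl
    simp [h1, h2] at hv

theorem Mt.insert {N : Finset (Sym2 V)} (h : Mt N) {x y : V} (hxy : x ≠ y) (hx : ¬ Cv N x)
    (hy : ¬ Cv N y) : Mt (insert s(x, y) N) := by
  have key : ∀ f ∈ N, ∀ v, v ∈ s(x, y) → v ∉ f := by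
    intro f hf v hv hvf
    simp only [Sym2.mem_iff] at hv
    rcases hv with rfl | rfl
    · exact hx ⟨f, hf, hvf⟩
    · exact hy ⟨f, hf, hvf⟩
  constructor
  · intro e he
    simp only [Finset.coe_insert, Set.mem_insert_iff, Finset.mem_coe] at he
    rcases he with rfl | he
    · simpa using hxy
    · exact h.1 e he
  · intro e he f hf hne v hve hvf
    simp only [Finset.coe_insert, Set.mem_insert_iff, Finset.mem_coe] at he hf
    rcases he with rfl | he <;> rcases hf with rfl | hf
    · exact hne rfl
    · exact key f hf v hve hvf
    · exact key e he v hvf hve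
    · exact h.2 e he f hf hne v hve hvf

theorem not_mem_of_not_cv {N : Finset (Sym2 V)} {x y : V} (hx : ¬ Cv N x) : s(x, y) ∉ N :=
  fun h => hx ⟨_, h, by simp⟩

theorem card_ins {N : Finset (Sym2 V)} {x y : V} (hx : ¬ Cv N x) :
    (insert s(x, y) N).card = N.card + 1 :=
  Finset.card_insert_of_notMem (not_mem_of_not_cv hx)

/-- Exchange along the alternating path starting at `v`. -/
theorem exchange (k : ℕ) : ∀ (N N' : Finset (Sym2 V)), N.card = k → Mt N → Mt N' → ∀ v, Cv N v →
    ¬ Cv N' v → ∃ (w : V) (N1 N1' : Finset (Sym2 V)), Mt N1 ∧ Mt N1' ∧ w ≠ v ∧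
      N1 ⊆ N ∪ N' ∧ N1' ⊆ N ∪ N' ∧
      (∀ a, a ≠ v → a ≠ w → (Cv N1 a ↔ Cv N a)) ∧
      (∀ a, a ≠ v → a ≠ w → (Cv N1' a ↔ Cv N' a)) ∧
      ¬ Cv N1 v ∧ Cv N1' v ∧ (Cv N1 w ↔ ¬ Cv N w) ∧ (Cv N1' w ↔ ¬ Cv N' w) ∧
      ((Cv N w ∧ ¬ Cv N' w ∧ N1.card + 1 = N.card ∧ N1'.card = N'.card + 1) ∨
       (¬ Cv N w ∧ Cv N' w ∧ N1.card = N.card ∧ N1'.card = N'.card)) := by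
  induction k with
  | zero =>
    intro N N' hk _ _ v hv
    rw [Finset.card_eq_zero] at hk
    subst hk
    obtain ⟨e, he, _⟩ := hv
    simp at he
  | succ k ih =>
    intro N N' hk hN hN' v hv hv'
    obtain ⟨u, hu⟩ := hv.edge
    have hvu : v ≠ u := hN.ne hu
    have hcu : Cv N u := ⟨_, hu, by simp⟩
    have hc2 := hN.cv_erase hu
    have hcard := Finset.card_erase_add_one hu
    by_cases hu' : Cv N' u
    · obtain ⟨t, ht⟩ := hu'.edge
      have hut : u ≠ t := hN'.ne ht
      have hct : Cv N' t := ⟨_, ht, by simp⟩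
      have htv : t ≠ v := by rintro rfl; exact hv' hct
      have hc2' := hN'.cv_erase ht
      have hcard' := Finset.card_erase_add_one ht
      have hM2 : Mt (N.erase s(v, u)) := hN.subset (Finset.erase_subset _ _)
      have hM2' : Mt (N'.erase s(u, t)) := hN'.subset (Finset.erase_subset _ _)
      by_cases htN : Cv N t
      · obtain ⟨w, N3, N3', h1, h2, h3, h4, h5, h6, h7, h8, h9, h10, h11, h12⟩ :=
          ih (N.erase s(v, u)) (N'.erase s(u, t)) (by omega) hM2 hM2' t (by grind) (by grind)
        have hwu : w ≠ u := by grind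
        have hwv : w ≠ v := by grind
        have hu3 : ¬ Cv N3 u := by grind
        have hu3' : ¬ Cv N3' u := by grind
        have hv3' : ¬ Cv N3' v := by grind
        refine ⟨w, insert s(u, t) N3, insert s(v, u) N3', h1.insert hut hu3 h8,
          h2.insert hvu hv3' hu3', hwv, ?_, ?_, ?_, ?_, ?_, ?_, ?_, ?_, ?_⟩
        · exact Finset.insert_subset (Finset.mem_union_right _ ht) (h4.trans
            (Finset.union_subset_union (Finset.erase_subset _ _) (Finset.erase_subset _ _)))
        · exact Finset.insert_subset (Finset.mem_union_left _ hu) (h5.trans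
            (Finset.union_subset_union (Finset.erase_subset _ _) (Finset.erase_subset _ _)))
        · intro a ha ha'
          rw [Cv_insert]
          have q1 := h6 a
          have q2 := hc2 a
          clear h4 h5 ih h6 h7 hc2 hc2' h12
          grind
        · intro a ha ha'
          rw [Cv_insert]
          have q1 := h7 a
          have q2 := hc2' a
          clear h4 h5 ih h6 h7 hc2 hc2' h12
          grind
        · rw [Cv_insert]
          have q1 := h6 v
          have q2 := hc2 v
          clear h4 h5 ih h6 h7 hc2 hc2' h12
          grind
        · rw [Cv_insert]
          simp
        · rw [Cv_insert]
          have q2 := hc2 w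
          clear h4 h5 ih h6 h7 hc2 hc2' h12
          grind
        · rw [Cv_insert]
          have q2 := hc2' w
          clear h4 h5 ih h6 h7 hc2 hc2' h12
          grind
        · rw [card_ins hu3, card_ins hv3']
          have q1 := hc2 w
          have q2 := hc2' w
          clear h4 h5 ih h6 h7 hc2 hc2'
          have q3 : Cv (N.erase s(v, u)) w ↔ Cv N w := by rw [q1]; simp [hwu, hwv]
          have q4 : Cv (N'.erase s(u, t)) w ↔ Cv N' w := by rw [q2]; simp [hwu, h3]
          rw [q3, q4] at h12
          rcases h12 with ⟨p1, p2, p3, p4⟩ | ⟨p1, p2, p3, p4⟩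
          · exact Or.inl ⟨p1, p2, by omega, by omega⟩
          · exact Or.inr ⟨p1, p2, by omega, by omega⟩
      · have hu3 : ¬ Cv (N.erase s(v, u)) u := by grind
        have ht3 : ¬ Cv (N.erase s(v, u)) t := by grind
        have hu3' : ¬ Cv (N'.erase s(u, t)) u := by grind
        have hv3' : ¬ Cv (N'.erase s(u, t)) v := by grind
        refine ⟨t, insert s(u, t) (N.erase s(v, u)), insert s(v, u) (N'.erase s(u, t)),
          hM2.insert hut hu3 ht3, hM2'.insert hvu hv3' hu3', htv, ?_, ?_, ?_, ?_, ?_, ?_, ?_, ?_, ?_⟩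
        · exact Finset.insert_subset (Finset.mem_union_right _ ht)
            ((Finset.erase_subset _ _).trans Finset.subset_union_left)
        · exact Finset.insert_subset (Finset.mem_union_left _ hu)
            ((Finset.erase_subset _ _).trans Finset.subset_union_right)
        · intro a ha ha'; rw [Cv_insert]; grind
        · intro a ha ha'; rw [Cv_insert]; grind
        · rw [Cv_insert]; grind
        · rw [Cv_insert]; grind
        · rw [Cv_insert]; grind
        · rw [Cv_insert]; grind
        · rw [card_ins hu3, card_ins hv3']
          grind
    · refine ⟨u, N.erase s(v, u), insert s(v, u) N', hN.subset (Finset.erase_subset _ _),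
        hN'.insert hvu hv' hu', hvu.symm, ?_, ?_, ?_, ?_, ?_, ?_, ?_, ?_, ?_⟩
      · exact (Finset.erase_subset _ _).trans Finset.subset_union_left
      · exact Finset.insert_subset (Finset.mem_union_left _ hu) Finset.subset_union_right
      · grind
      · intro a ha ha'; rw [Cv_insert]; grind
      · grind
      · rw [Cv_insert]; grind
      · grind
      · rw [Cv_insert]; grind
      · rw [card_ins hv']
        grind

/-- the finite set of covered vertices -/
def covF (N : Finset (Sym2 V)) : Finset V := N.biUnion Sym2.toFinset

theorem mem_covF {N : Finset (Sym2 V)} {v : V} : v ∈ covF N ↔ Cv N v := by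
  simp [covF, Cv]

theorem Mt.card_covF {N : Finset (Sym2 V)} (h : Mt N) : (covF N).card = 2 * N.card := by
  unfold covF
  rw [Finset.card_biUnion, Finset.sum_const_nat (m := 2), mul_comm]
  · intro e he
    exact Sym2.card_toFinset_of_not_isDiag e (h.1 e he)
  · intro e he f hf hne
    change Disjoint _ _
    rw [Finset.disjoint_left]
    intro v hve hvf
    rw [Sym2.mem_toFinset] at hve hvf
    exact h.2 e he f hf hne v hve hvf

/-- class counting -/
theorem class_count (N K : Finset (Sym2 V)) (hN : Mt N) (hK : Mt K) (hlt : N.card < K.card)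
    (r : Setoid V) (hrN : ∀ x y, s(x, y) ∈ N → r x y) (hrK : ∀ x y, s(x, y) ∈ K → r x y) :
    ∃ u v, u ≠ v ∧ r u v ∧ ¬ Cv N u ∧ ¬ Cv N v := by
  classical
  let g : Sym2 V → Sym2 (Quotient r) := Sym2.map (Quotient.mk r)
  have hg : ∀ x y, r x y → ∀ v ∈ s(x, y), g s(x, y) = s(Quotient.mk r v, Quotient.mk r v) := by
    intro x y hxy v hv
    have : Quotient.mk r x = Quotient.mk r y := Quotient.sound hxy
    simp only [Sym2.mem_iff] at hv
    rcases hv with rfl | rfl <;> simp [g, this]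
  have hgN : ∀ e ∈ N, ∀ v ∈ e, g e = s(Quotient.mk r v, Quotient.mk r v) := by
    intro e he
    induction e using Sym2.ind with
    | _ x y => exact hg x y (hrN x y he)
  have hgK : ∀ e ∈ K, ∀ v ∈ e, g e = s(Quotient.mk r v, Quotient.mk r v) := by
    intro e he
    induction e using Sym2.ind with
    | _ x y => exact hg x y (hrK x y he)
  have h1 := Finset.card_eq_sum_card_fiberwise (f := g) (s := N) (t := (N ∪ K).image g)
    (fun e he => Finset.mem_image_of_mem g (Finset.mem_union_left _ he))
  have h2 := Finset.card_eq_sum_card_fiberwise (f := g) (s := K) (t := (N ∪ K).image g)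
    (fun e he => Finset.mem_image_of_mem g (Finset.mem_union_right _ he))
  rw [h1, h2] at hlt
  obtain ⟨c, -, hc⟩ := Finset.exists_lt_of_sum_lt hlt
  have hMN : Mt (N.filter (g · = c)) := hN.subset (Finset.filter_subset _ _)
  have hMK : Mt (K.filter (g · = c)) := hK.subset (Finset.filter_subset _ _)
  have h3 : 1 < (covF (K.filter (g · = c)) \ covF (N.filter (g · = c))).card := by
    have := Finset.le_card_sdiff (covF (N.filter (g · = c))) (covF (K.filter (g · = c)))
    rw [hMN.card_covF, hMK.card_covF] at this
    omega
  obtain ⟨u, hu, v, hv, huv⟩ := Finset.one_lt_card.1 h3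
  have key : ∀ u ∈ covF (K.filter (g · = c)) \ covF (N.filter (g · = c)),
      c = s(Quotient.mk r u, Quotient.mk r u) ∧ ¬ Cv N u := by
    intro u hu
    rw [Finset.mem_sdiff, mem_covF, mem_covF] at hu
    obtain ⟨⟨e, he, hue⟩, hu2⟩ := hu
    rw [Finset.mem_filter] at he
    have hcu : c = s(Quotient.mk r u, Quotient.mk r u) := by
      rw [← he.2]; exact hgK e he.1 u hue
    refine ⟨hcu, ?_⟩
    rintro ⟨f, hf, huf⟩
    exact hu2 ⟨f, Finset.mem_filter.2 ⟨hf, by rw [hcu]; exact hgN f hf u huf⟩, huf⟩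
  obtain ⟨a1, a2⟩ := key u hu
  obtain ⟨b1, b2⟩ := key v hv
  refine ⟨u, v, huv, ?_, a2, b2⟩
  rw [a1] at b1
  have : Quotient.mk r u = Quotient.mk r v := by simpa using b1
  exact Quotient.exact this

end

/-- some matching of size `k` in `G` misses `v` -/
def Miss (G : Set (Sym2 V)) (k : ℕ) (v : V) : Prop :=
  ∃ N : Finset (Sym2 V), (N : Set (Sym2 V)) ⊆ G ∧ Mt N ∧ N.card = k ∧ ¬ Cv N v

/-- `G` has a matching of size `k` -/
def Has (G : Set (Sym2 V)) (k : ℕ) : Prop :=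
  ∃ N : Finset (Sym2 V), (N : Set (Sym2 V)) ⊆ G ∧ Mt N ∧ N.card = k

theorem Miss.mono {G G' : Set (Sym2 V)} (h : G ⊆ G') {k : ℕ} {v : V} (hm : Miss G k v) :
    Miss G' k v := by
  obtain ⟨N, h1, h2⟩ := hm
  exact ⟨N, h1.trans h, h2⟩

section
variable [DecidableEq V]

/-- the case with no edges leaving the set of missable vertices -/
theorem closed_case (k : ℕ) (G : Set (Sym2 V)) (K : Finset (Sym2 V)) (hno : ¬ Has G (k + 1))
    (hhas : Has G k) (hK : Mt K) (hKc : k + 1 ≤ K.card)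
    (H1 : ∀ e ∈ K, ¬ Has (insert e G) (k + 1))
    (hG : ∀ x y, s(x, y) ∈ G → Miss G k x → Miss G k y)
    (hGK : ∀ x y, s(x, y) ∈ K → Miss G k x → Miss G k y) : False := by
  let R : V → V → Prop := fun u v => u = v ∨ ((Miss G k u ↔ Miss G k v) ∧
    ∀ N : Finset (Sym2 V), (N : Set (Sym2 V)) ⊆ G → Mt N → N.card = k → ¬ Cv N u → Cv N v)
  have hsymm : ∀ u v, R u v → R v u := by
    rintro u v (h | ⟨h1, h2⟩)
    · exact Or.inl h.symm
    · refine Or.inr ⟨h1.symm, fun N a b c d => ?_⟩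
      by_contra h
      exact d (h2 N a b c h)
  have htrans : ∀ u v w, R u v → R v w → R u w := by
    rintro u v w (rfl | ⟨h1, h2⟩) h
    · exact h
    rcases h with rfl | ⟨h3, h4⟩
    · exact Or.inr ⟨h1, h2⟩
    refine or_iff_not_imp_left.2 fun huw => ⟨h1.trans h3, fun N a b c d => ?_⟩
    by_contra hw
    have hv := h2 N a b c d
    obtain ⟨N', a', b', c', d'⟩ := h1.1 ⟨N, a, b, c, d⟩
    obtain ⟨t, N1, N1', m1, m2, m3, m4, m5, m6, m7, m8, m9, m10, m11, m12⟩ :=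
      exchange _ N N' rfl b b' v hv d'
    have hsub : ∀ P : Finset (Sym2 V), P ⊆ N ∪ N' → (P : Set (Sym2 V)) ⊆ G := by
      intro P hP e he
      have := hP he
      rcases Finset.mem_union.1 this with h | h
      · exact a h
      · exact a' h
    rcases m12 with ⟨n1, n2, n3, n4⟩ | ⟨n1, n2, n3, n4⟩
    · exact hno ⟨N1', hsub _ m5, m2, by omega⟩
    · have hvu : u ≠ v := by rintro rfl; exact d hv
      have hvw : w ≠ v := by rintro rfl; exact hw hv
      by_cases htu : u = t
      · have : w ≠ t := fun h => huw (htu.trans h.symm)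
        exact hw ((m6 w hvw this).1 (h4 N1 (hsub _ m4) m1 (by omega) m8))
      · have := mt (m6 u hvu htu).1 d
        exact m8 (h2 N1 (hsub _ m4) m1 (by omega) this)
  let r : Setoid V := ⟨R, fun _ => Or.inl rfl, fun h => hsymm _ _ h, fun h h' => htrans _ _ _ h h'⟩
  obtain ⟨N, a, b, c⟩ := hhas
  obtain ⟨u, v, huv, hr, hu, hv⟩ := class_count N K b hK (by omega) r
    (by
      intro x y hxy
      refine Or.inr ⟨⟨hG x y (a hxy), hG y x (by rw [Sym2.eq_swap]; exact a hxy)⟩, ?_⟩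
      intro P a' b' c' d'
      by_contra hy
      refine hno ⟨insert s(x, y) P, ?_, b'.insert (b.ne hxy) d' hy, by rw [card_ins d', c']⟩
      rw [Finset.coe_insert]
      exact Set.insert_subset (a hxy) a')
    (by
      intro x y hxy
      refine Or.inr ⟨⟨hGK x y hxy, hGK y x (by rw [Sym2.eq_swap]; exact hxy)⟩, ?_⟩
      intro P a' b' c' d'
      by_contra hy
      refine H1 _ hxy ⟨insert s(x, y) P, ?_, b'.insert (hK.ne hxy) d' hy, by rw [card_ins d', c']⟩
      rw [Finset.coe_insert]
      exact Set.insert_subset_insert a')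
  rcases hr with h | ⟨-, h⟩
  · exact huv h
  · exact hv (h N a b c hu)

theorem main_claim (k : ℕ) : ∀ (G : Set (Sym2 V)) (K : Finset (Sym2 V)), ¬ Has G (k + 1) →
    Has G k → Mt K → k + 1 ≤ K.card →
    ∃ e ∈ K, Has (insert e G) (k + 1) ∨ ∃ z, ¬ Miss G k z ∧ Miss (insert e G) k z := by
  induction k with
  | zero =>
    intro G K hno hhas hK hKc
    by_contra hcon
    push Not at hcon
    have hall : ∀ v, Miss G 0 v := fun v => ⟨∅, by simp, ⟨by simp, by simp⟩, rfl, by simp [Cv]⟩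
    exact closed_case 0 G K hno hhas hK hKc (fun e he => (hcon e he).1)
      (fun _ y _ _ => hall y) (fun _ y _ _ => hall y)
  | succ k ih =>
    intro G K hno hhas hK hKc
    by_contra hcon
    push Not at hcon
    have H1 : ∀ e ∈ K, ¬ Has (insert e G) (k + 1 + 1) := fun e he => (hcon e he).1
    have H2 : ∀ e ∈ K, ∀ z, Miss (insert e G) (k + 1) z → Miss G (k + 1) z := by
      intro e he z hz
      by_contra h
      exact (hcon e he).2 z h hz
    by_cases hG : ∀ x y, s(x, y) ∈ G → Miss G (k + 1) x → Miss G (k + 1) y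
    · refine closed_case (k + 1) G K hno hhas hK hKc H1 hG ?_
      intro x y hxy hx
      by_contra hy
      obtain ⟨N, a, b, c, d⟩ := hx
      have hyc : Cv N y := by
        by_contra h
        exact hy ⟨N, a, b, c, h⟩
      obtain ⟨y', hy'⟩ := hyc.edge
      have hc := b.cv_erase hy'
      have hne := b.ne hy'
      have hxx : x ≠ y' := by
        rintro rfl; exact d ⟨_, hy', by simp⟩
      have hxy2 := hK.ne hxy
      have hxn : ¬ Cv (N.erase s(y, y')) x := by grind
      have hcard := Finset.card_erase_add_one hy'
      have : Miss (insert s(x, y) G) (k + 1) y' := by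
        refine ⟨insert s(x, y) (N.erase s(y, y')), ?_,
          (b.subset (Finset.erase_subset _ _)).insert hxy2 hxn (by grind),
          by rw [card_ins hxn]; omega, by rw [Cv_insert]; grind⟩
        rw [Finset.coe_insert]
        exact Set.insert_subset_insert
          (fun e he => a (Finset.mem_of_mem_erase he))
      have h3 := H2 _ hxy _ this
      exact hy (hG y' y (by rw [Sym2.eq_swap]; exact a hy') h3)
    · push Not at hG
      obtain ⟨x, y, hxyG, hx, hy⟩ := hG
      let G' : Set (Sym2 V) := {e ∈ G | y ∉ e}
      have hG'G : G' ⊆ G := fun e he => he.1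
      have hdel : ∀ N : Finset (Sym2 V), (N : Set (Sym2 V)) ⊆ G → Mt N → N.card = k + 1 →
          ∃ P : Finset (Sym2 V), (P : Set (Sym2 V)) ⊆ G' ∧ Mt P ∧ P.card = k ∧ P ⊆ N := by
        intro N a b c
        have hyc : Cv N y := by
          by_contra h
          exact hy ⟨N, a, b, c, h⟩
        obtain ⟨y', hy'⟩ := hyc.edge
        have hcard := Finset.card_erase_add_one hy'
        refine ⟨N.erase s(y, y'), ?_, b.subset (Finset.erase_subset _ _), by omega,
          Finset.erase_subset _ _⟩
        intro e he
        have he' := Finset.mem_erase.1 he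
        refine ⟨a he'.2, fun hye => he'.1 (b.uniq he'.2 hy' hye (by simp))⟩
      have hno' : ¬ Has G' (k + 1) := by
        rintro ⟨N, a, b, c⟩
        refine hy ⟨N, a.trans hG'G, b, c, ?_⟩
        rintro ⟨e, he, hye⟩
        exact (a he).2 hye
      have hhas' : Has G' k := by
        obtain ⟨N, a, b, c⟩ := hhas
        obtain ⟨P, h1, h2, h3, -⟩ := hdel N a b c
        exact ⟨P, h1, h2, h3⟩
      have hKcard : k + 1 ≤ (K.filter (y ∉ ·)).card := by
        have h1 := Finset.card_filter_add_card_filter_not (s := K) (y ∈ ·)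
        have h2 : (K.filter (y ∈ ·)).card ≤ 1 := by
          rw [Finset.card_le_one]
          intro e he f hf
          rw [Finset.mem_filter] at he hf
          exact hK.uniq he.1 hf.1 he.2 hf.2
        omega
      obtain ⟨e, he, hor⟩ := ih G' (K.filter (y ∉ ·)) hno' hhas'
        (hK.subset (Finset.filter_subset _ _)) hKcard
      rw [Finset.mem_filter] at he
      have hmissy : ∀ N : Finset (Sym2 V), (N : Set (Sym2 V)) ⊆ insert e G' → ¬ Cv N y := by
        rintro N hN ⟨f, hf, hyf⟩
        rcases hN hf with rfl | h
        · exact he.2 hyf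
        · exact h.2 hyf
      have hins : insert e G' ⊆ insert e G := Set.insert_subset_insert hG'G
      rcases hor with ⟨N, a, b, c⟩ | ⟨z, hz, N, a, b, c, d⟩
      · exact hy (H2 e he.1 y ⟨N, a.trans hins, b, c, hmissy N a⟩)
      · have hzG : ¬ Miss G (k + 1) z := by
          rintro ⟨P, a', b', c', d'⟩
          obtain ⟨Q, h1, h2, h3, h4⟩ := hdel P a' b' c'
          exact hz ⟨Q, h1, h2, h3, fun h => d' (h.mono h4)⟩
        have hzy : z ≠ y := by
          rintro rfl
          obtain ⟨P, a', b', c'⟩ := hhas'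
          exact hz ⟨P, a', b', c', hmissy P (a'.trans (Set.subset_insert _ _))⟩
        have hxy : x ≠ y := by
          rintro rfl
          exact hy hx
        obtain ⟨N0, a0, b0, c0, d0⟩ := hx
        have hyc : Cv N0 y := by
          by_contra h
          exact hy ⟨N0, a0, b0, c0, h⟩
        obtain ⟨t, N1, N1', m1, m2, m3, m4, m5, m6, m7, m8, m9, m10, m11, m12⟩ :=
          exchange _ N0 N rfl b0 b y hyc (hmissy N a)
        have hsub : ∀ P : Finset (Sym2 V), P ⊆ N0 ∪ N → (P : Set (Sym2 V)) ⊆ insert e G := by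
          intro P hP f hf
          rcases Finset.mem_union.1 (hP hf) with h | h
          · exact Set.mem_insert_of_mem _ (a0 h)
          · exact hins (a h)
        rcases m12 with ⟨n1, n2, n3, n4⟩ | ⟨n1, n2, n3, n4⟩
        · by_cases htz : z = t
          · subst htz
            have hxz : x ≠ z := by rintro rfl; exact d0 n1
            have hx1 : ¬ Cv N1 x := mt (m6 x hxy hxz).1 d0
            refine hzG (H2 e he.1 z ⟨insert s(x, y) N1, ?_, m1.insert hxy hx1 m8,
              by rw [card_ins hx1]; omega, by rw [Cv_insert]; grind⟩)
            rw [Finset.coe_insert]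
            exact Set.insert_subset (Set.mem_insert_of_mem _ hxyG) (hsub _ m4)
          · exact hzG (H2 e he.1 z ⟨N1', hsub _ m5, m2, by omega, mt (m7 z hzy htz).1 d⟩)
        · exact hy (H2 e he.1 y ⟨N1, hsub _ m4, m1, by omega, m8⟩)

/-- Rainbow matching in terms of color sets. -/
def Rb {m : ℕ} (M : Fin m → Finset (Sym2 V)) (k : ℕ) : Prop :=
  ∃ (T : Finset (Fin m)) (e : Fin m → Sym2 V), (∀ i ∈ T, e i ∈ M i) ∧ Mt (T.image e) ∧
    (T.image e).card = k ∧ T.card = k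

theorem rb_of_has {m : ℕ} (M : Fin m → Finset (Sym2 V)) (k : ℕ) (T : Finset (Fin m))
    (e : Fin m → Sym2 V) (he : ∀ i ∈ T, e i ∈ M i)
    (h : Has ((T.image e : Finset (Sym2 V)) : Set (Sym2 V)) k) : Rb M k := by
  obtain ⟨N, a, b, c⟩ := h
  have a' : N ⊆ T.image e := by exact_mod_cast a
  have hex : ∀ f : {x // x ∈ N}, ∃ i ∈ T, e i = f.1 := fun f => Finset.mem_image.1 (a' f.2)
  choose g hgT hg using hex
  have himg : (N.attach.image g).image e = N := by
    ext f
    simp only [Finset.mem_image, Finset.mem_attach, true_and, exists_exists_eq_and]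
    constructor
    · rintro ⟨x, rfl⟩
      rw [hg]; exact x.2
    · intro hf
      exact ⟨⟨f, hf⟩, hg _⟩
  refine ⟨N.attach.image g, e, ?_, by rw [himg]; exact b, by rw [himg]; exact c, ?_⟩
  · intro i hi
    obtain ⟨f, -, rfl⟩ := Finset.mem_image.1 hi
    exact he _ (hgT f)
  · rw [Finset.card_image_of_injective, Finset.card_attach, c]
    intro x y hxy
    apply Subtype.ext
    rw [← hg x, ← hg y, hxy]

theorem rb_step (n : ℕ) (M : Fin (3 * n - 2) → Finset (Sym2 V))
    (hM : ∀ i, Mt (M i) ∧ (M i).card = n) (k : ℕ) (hk : k < n) (h : Rb M k) : Rb M (k + 1) := by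
  by_contra hcon
  obtain ⟨T0, e0, he0, hm0, hc0, hT0⟩ := h
  have key : ∀ j, j ≤ 2 * k + 1 → ∃ (T : Finset (Fin (3 * n - 2))) (e : Fin (3 * n - 2) → Sym2 V)
      (U : Finset V), T.card = k + j ∧ (∀ i ∈ T, e i ∈ M i) ∧
      Has ((T.image e : Finset (Sym2 V)) : Set (Sym2 V)) k ∧ U.card + j ≤ 2 * k ∧
      ∀ v, v ∉ U → Miss ((T.image e : Finset (Sym2 V)) : Set (Sym2 V)) k v := by
    intro j
    induction j with
    | zero =>
      intro _
      refine ⟨T0, e0, covF (T0.image e0), by simpa using hT0, he0,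
        ⟨_, subset_rfl, hm0, hc0⟩, by rw [hm0.card_covF, hc0]; omega, ?_⟩
      intro v hv
      rw [mem_covF] at hv
      exact ⟨_, subset_rfl, hm0, hc0, hv⟩
    | succ j ih =>
      intro hj
      obtain ⟨T, e, U, h1, h2, h3, h4, h5⟩ := ih (by omega)
      obtain ⟨i, hi⟩ : ∃ i, i ∉ T := by
        by_contra hall
        push Not at hall
        have : T = Finset.univ := Finset.eq_univ_of_forall hall
        rw [this, Finset.card_univ, Fintype.card_fin] at h1
        omega
      have hno : ¬ Has ((T.image e : Finset (Sym2 V)) : Set (Sym2 V)) (k + 1) :=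
        fun hh => hcon (rb_of_has M _ T e h2 hh)
      obtain ⟨f, hf, hor⟩ := main_claim k _ (M i) hno h3 (hM i).1 (by rw [(hM i).2]; omega)
      have himg : (((insert i T).image (Function.update e i f) : Finset (Sym2 V)) : Set (Sym2 V))
          = insert f ((T.image e : Finset (Sym2 V)) : Set (Sym2 V)) := by
        rw [Finset.image_insert, Function.update_self, Finset.coe_insert]
        congr 2
        apply Finset.image_congr
        intro a ha
        have : a ≠ i := by rintro rfl; exact hi ha
        simp [this]
      have hmem : ∀ a ∈ insert i T, Function.update e i f a ∈ M a := by
        intro a ha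
        by_cases hai : a = i
        · subst hai; simpa using hf
        · rw [Function.update_of_ne hai]
          exact h2 a (Finset.mem_of_mem_insert_of_ne ha hai)
      rcases hor with hor | ⟨z, hz, hz'⟩
      · exact absurd (rb_of_has M _ _ _ hmem (by rw [himg]; exact hor)) hcon
      · have hzU : z ∈ U := by
          by_contra hh
          exact hz (h5 z hh)
        have hUc := Finset.card_erase_add_one hzU
        refine ⟨insert i T, Function.update e i f, U.erase z,
          by rw [Finset.card_insert_of_notMem hi]; omega, hmem, ?_, by omega, ?_⟩
        · rw [himg]
          obtain ⟨N, a, b, c⟩ := h3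
          exact ⟨N, a.trans (Set.subset_insert _ _), b, c⟩
        · intro v hv
          rw [himg]
          by_cases hvz : v = z
          · rw [hvz]; exact hz'
          · exact (h5 v (fun hh => hv (Finset.mem_erase.2 ⟨hvz, hh⟩))).mono (Set.subset_insert _ _)
  obtain ⟨T, e, U, -, -, -, h4, -⟩ := key (2 * k + 1) le_rfl
  omega

end

/-- main theorem: any family of `3n − 2` matchings of size `n` in an arbitrary
graph has a rainbow matching of size `n`. -/
theorem stmt_18 {V : Type*} [DecidableEq V] (n : ℕ)
    (M : Fin (3 * n - 2) → Finset (Sym2 V))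
    (hM : ∀ i, IsMatching ((M i : Finset (Sym2 V)) : Set (Sym2 V)) ∧ (M i).card = n) :
    HasRainbow n M := by
  have hR : ∀ k, k ≤ n → Rb M k := by
    intro k
    induction k with
    | zero =>
      intro _
      have hne : ∀ i, ∃ x, x ∈ M i := fun i => Finset.card_pos.1 (by
        rw [(hM i).2]; have := i.2; omega)
      choose e he using hne
      exact ⟨∅, e, by simp, ⟨by simp, by simp⟩, rfl, rfl⟩
    | succ k ih =>
      intro hk
      exact rb_step n M hM k (by omega) (ih (by omega))
  obtain ⟨T, e, h1, h2, h3, h4⟩ := hR n le_rfl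
  let φ := T.orderEmbOfFin h4
  have hinj : Set.InjOn e T := Finset.injOn_of_card_image_eq (by rw [h3, h4])
  have hφ : ∀ j, φ j ∈ T := fun j => Finset.orderEmbOfFin_mem T h4 j
  refine ⟨φ, fun j => e (φ j), φ.injective, fun j => h1 _ (hφ j), ?_, ?_⟩
  · intro a b hab
    exact φ.injective (hinj (hφ a) (hφ b) hab)
  · refine Mt.subset h2 ?_
    intro f hf
    obtain ⟨j, -, rfl⟩ := Finset.mem_image.1 hf
    exact Finset.mem_image_of_mem e (hφ j)
end
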